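/- arXiv:2308.05208 — 2 statements merged into one kernel-verified Lean document; each statement's English description precedes it below -/
import Mathlib

section
/- For fixed integers d ≥ 2 and k ≥ 1, the quantity ψ^max_{d,k}(n) grows like Θ(n^{2dk}): there exist constants c_1, c_2 > 0 (depending only on d and k) such that c_1 n^{2dk} ≤ ψ^max_{d,k}(n) ≤ c_2 n^{2dk} for all sufficiently large n. -/
/-- `sumDist V x = Σ_{v ∈ V} ‖x − v‖` (with multiplicity): the sum of Euclidean
distances from `x` to the points of the multiset `V`. -/
noncomputable def sumDist {d : ℕ} (V : Multiset (EuclideanSpace ℝ (Fin d)))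
    (x : EuclideanSpace ℝ (Fin d)) : ℝ :=
  (V.map fun v => dist x v).sum

/-- `PsiSet k n C` is the set of orderings `Σ_V^C` of the `n`-element set `C ⊆ ℝ^d`,
recorded as injective enumerations `σ : Fin n → ℝ^d` of `C`, witnessed by some
`k`-element multiset `V` of vantage points which distinguishes the points of `C`
(i.e. `D_V` is injective on `C`) and along which `D_V` is strictly increasing. -/
def PsiSet {d : ℕ} (k n : ℕ) (C : Finset (EuclideanSpace ℝ (Fin d))) :
    Set (Fin n → EuclideanSpace ℝ (Fin d)) :=
  {σ | Function.Injective σ ∧ (∀ i, σ i ∈ C) ∧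
    ∃ V : Multiset (EuclideanSpace ℝ (Fin d)), Multiset.card V = k ∧
      Set.InjOn (sumDist V) ↑C ∧ StrictMono fun i => sumDist V (σ i)}

/-- `ψ_k(C)`, the number of orderings of `C` witnessed by `k`-element multisets. -/
noncomputable def psiCount {d : ℕ} (k : ℕ) (C : Finset (EuclideanSpace ℝ (Fin d))) : ℕ :=
  Nat.card (PsiSet k C.card C)

/-- `ψ^max_{d,k}(n)`: the maximum of `ψ_k(C)` over all `n`-element sets `C ⊆ ℝ^d`. -/
noncomputable def psiMax (d k n : ℕ) : ℕ :=
  sSup {m | ∃ C : Finset (EuclideanSpace ℝ (Fin d)), C.card = n ∧ psiCount k C = m}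

namespace MvPolynomial

/-- A real polynomial vanishing near a point is zero. -/
theorem eq_zero_of_eventually_eval_eq_zero {ι : Type*} [Fintype ι] {p : MvPolynomial ι ℝ}
    {x : ι → ℝ} (h : ∀ᶠ y in nhds x, eval y p = 0) : p = 0 := by
  obtain ⟨ε, hε, hb⟩ := Metric.eventually_nhds_iff_ball.1 h
  refine funext_set (fun i => Metric.ball (x i) ε) (fun i => ?_) fun y hy => ?_
  · rw [Real.ball_eq_Ioo]
    exact Set.Ioo_infinite (by linarith)
  · rw [map_zero]
    refine hb y ?_
    rw [ball_pi _ hε]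
    exact hy

/-- The differential of a real polynomial, as a continuous linear form. -/
noncomputable def differential {ι : Type*} [Fintype ι] (p : MvPolynomial ι ℝ) (x : ι → ℝ) :
    (ι → ℝ) →L[ℝ] ℝ :=
  ∑ i, eval x (pderiv i p) • ContinuousLinearMap.proj (R := ℝ) (φ := fun _ : ι => ℝ) i

theorem hasStrictFDerivAt_eval {ι : Type*} [Fintype ι] (p : MvPolynomial ι ℝ) (x : ι → ℝ) :
    HasStrictFDerivAt (fun y : ι → ℝ => eval y p) (differential p x) x := by
  classical
  induction p using MvPolynomial.induction_on with
  | C a =>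
    have : differential (C a : MvPolynomial ι ℝ) x = 0 := by
      ext; simp [differential]
    rw [this]
    simpa using hasStrictFDerivAt_const a x
  | add p q hp hq =>
    have : differential (p + q) x = differential p x + differential q x := by
      simp [differential, add_smul, Finset.sum_add_distrib]
    rw [this]
    simpa only [map_add] using hp.fun_add hq
  | mul_X p i hp =>
    have : differential (p * X i) x = eval x p • ContinuousLinearMap.proj (R := ℝ)
        (φ := fun _ : ι => ℝ) i + x i • differential p x := by
      ext v
      simp [differential, pderiv_X, Pi.single_apply, Finset.mul_sum, add_mul,
        Finset.sum_add_distrib, apply_ite]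
      exact Finset.sum_congr rfl fun j _ => by ring
    rw [this]
    simpa using hp.fun_mul (ContinuousLinearMap.proj (R := ℝ) (φ := fun _ : ι => ℝ) i).hasStrictFDerivAt

theorem totalDegree_pderiv_le {ι : Type*} (p : MvPolynomial ι ℝ) (i : ι) :
    (pderiv i p).totalDegree ≤ p.totalDegree := by
  classical
  conv_lhs => rw [← support_sum_monomial_coeff p, map_sum]
  refine (totalDegree_finsetSum _ _).trans (Finset.sup_le fun m hm => ?_)
  rw [pderiv_monomial]
  refine (totalDegree_monomial_le _ _).trans ?_
  exact (Finsupp.degree_mono tsub_le_self).trans (le_totalDegree hm)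

/-- Polynomials of bounded total degree span a space of bounded dimension. -/
theorem finrank_restrictTotalDegree_le {ι : Type*} [Fintype ι] (L : ℕ) :
    Module.Finite ℝ (restrictTotalDegree ι ℝ L) ∧
      Module.finrank ℝ (restrictTotalDegree ι ℝ L) ≤ (L + 1) ^ Fintype.card ι := by
  classical
  have b := basisRestrictSupport (σ := ι) ℝ {n | n.degree ≤ L}
  let g : {n : ι →₀ ℕ | n.degree ≤ L} → (ι → Fin (L + 1)) := fun n i =>
    ⟨n.1 i, Nat.lt_succ_of_le ((Finsupp.le_degree i n.1).trans n.2)⟩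
  have hg : Function.Injective g := by
    intro m n h
    ext i
    exact congrArg Fin.val (congrFun h i)
  have : Finite {n : ι →₀ ℕ | n.degree ≤ L} := Finite.of_injective g hg
  have := Fintype.ofFinite {n : ι →₀ ℕ | n.degree ≤ L}
  refine ⟨Module.Finite.of_basis b, ?_⟩
  have h1 := Module.finrank_eq_card_basis b
  have h2 := Fintype.card_le_of_injective g hg
  simp only [Fintype.card_pi, Fintype.card_fin, Finset.prod_const, Finset.card_univ] at h2
  exact h1.trans_le h2

/-- A linear form separating finitely many points, as a polynomial of degree at most one. -/
theorem exists_linear_separating {ι : Type*} [Fintype ι] (Z : Finset (ι → ℝ)) :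
    ∃ h : MvPolynomial ι ℝ, h.totalDegree ≤ 1 ∧
      Set.InjOn (fun z : ι → ℝ => eval z h) Z := by
  classical
  obtain ⟨φ, hφ⟩ := Module.exists_dual_forall_apply_ne_zero (K := ℝ) (M := ι → ℝ)
    (fun z : Z.offDiag => z.1.1 - z.1.2) (fun z => by
      have := z.2
      rw [Finset.mem_offDiag] at this
      exact sub_ne_zero.2 this.2.2)
  refine ⟨∑ i, C (φ (Pi.single i 1)) * X i, ?_, ?_⟩
  · refine (totalDegree_finsetSum _ _).trans (Finset.sup_le fun i _ => ?_)
    refine (totalDegree_mul _ _).trans ?_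
    simp
  · have he : ∀ z : ι → ℝ, eval z (∑ i, C (φ (Pi.single i 1)) * X i) = φ z := by
      intro z
      rw [LinearMap.pi_apply_eq_sum_univ φ z]
      simp only [map_sum, map_mul, eval_C, eval_X, smul_eq_mul]
      refine Finset.sum_congr rfl fun i _ => ?_
      rw [mul_comm]
      congr 2
      ext j
      simp [Pi.single_apply, eq_comm]
    intro x hx y hy hxy
    simp only [he] at hxy
    by_contra hne
    refine hφ ⟨(x, y), Finset.mem_offDiag.2 ⟨hx, hy, hne⟩⟩ ?_
    simp [hxy]

/-- A weak form of Bézout's inequality: a square system of polynomial equations of degree at most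
`E` in `D` real variables has at most `(E * D + 1) ^ D` nondegenerate solutions. -/
theorem card_nondegenerate_zeros_le {ι : Type*} [Fintype ι] (F : ι → MvPolynomial ι ℝ) (E : ℕ)
    (hE : ∀ i, (F i).totalDegree ≤ E) (Z : Finset (ι → ℝ))
    (hnd : ∀ z ∈ Z, Filter.map (fun x i => eval x (F i)) (nhds z) = nhds 0) :
    Z.card ≤ (E * Fintype.card ι + 1) ^ Fintype.card ι := by
  classical
  obtain ⟨h, hdeg, hinj⟩ := exists_linear_separating Z
  set D := Fintype.card ι with hD
  set A := (E * D + 1) ^ D with hA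
  obtain ⟨hfin, hrank⟩ := finrank_restrictTotalDegree_le (ι := ι) (E * D * A + A)
  let w : (Fin (A + 1) × (ι → Fin (A + 1))) → restrictTotalDegree ι ℝ (E * D * A + A) := fun s =>
    ⟨h ^ (s.1 : ℕ) * ∏ i, F i ^ (s.2 i : ℕ), by
      rw [mem_restrictTotalDegree]
      refine (totalDegree_mul _ _).trans ?_
      have h1 : (h ^ (s.1 : ℕ)).totalDegree ≤ A :=
        (totalDegree_pow _ _).trans
          ((Nat.mul_le_mul (Nat.lt_succ_iff.1 s.1.2) hdeg).trans (by simp))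
      have h2 : (∏ i, F i ^ (s.2 i : ℕ)).totalDegree ≤ E * D * A := by
        refine (totalDegree_finsetProd _ _).trans ?_
        refine (Finset.sum_le_card_nsmul _ _ (A * E) fun i _ => ?_).trans ?_
        · exact (totalDegree_pow _ _).trans (Nat.mul_le_mul (Nat.lt_succ_iff.1 (s.2 i).2) (hE i))
        · rw [Finset.card_univ, smul_eq_mul, ← hD]
          exact le_of_eq (by ring)
      omega⟩
  have hdep : ¬ LinearIndependent ℝ w := by
    intro hli
    have h1 := hli.fintype_card_le_finrank
    simp only [Fintype.card_prod, Fintype.card_pi, Fintype.card_fin, Finset.prod_const,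
      Finset.card_univ, ← hD] at h1
    have h2 : (E * D * A + A + 1) ^ D ≤ A * (A + 1) ^ D := by
      rw [hA, ← mul_pow, ← hA]
      refine Nat.pow_le_pow_left ?_ _
      nlinarith
    have h3 : 0 < (A + 1) ^ D := by positivity
    nlinarith [hrank]
  rw [Fintype.linearIndependent_iff] at hdep
  push Not at hdep
  obtain ⟨c, hc, s₀, hs₀⟩ := hdep
  have hrel : ∀ x : ι → ℝ, ∑ a : Fin (A + 1), (∑ β : ι → Fin (A + 1),
      c (a, β) * ∏ i, (eval x (F i)) ^ (β i : ℕ)) * (eval x h) ^ (a : ℕ) = 0 := by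
    intro x
    have := congrArg (fun p : restrictTotalDegree ι ℝ (E * D * A + A) => eval x p.1) hc
    simp only [Submodule.coe_sum, Submodule.coe_smul, map_sum, smul_eval, w, map_mul, map_pow,
      map_prod, ZeroMemClass.coe_zero, map_zero, Fintype.sum_prod_type] at this
    rw [← this]
    refine Finset.sum_congr rfl fun a _ => ?_
    rw [Finset.sum_mul]
    exact Finset.sum_congr rfl fun β _ => by ring
  by_contra hlt
  push Not at hlt
  obtain ⟨U, hU, hdisj⟩ := (Z.finite_toSet.image (fun z : ι → ℝ => eval z h)).t2_separation
  have hcont : Continuous (fun x : ι → ℝ => eval x h) := MvPolynomial.continuous_eval h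
  have hev : ∀ᶠ y in nhds (0 : ι → ℝ), ∀ z ∈ Z, ∃ x : ι → ℝ,
      (fun i => eval x (F i)) = y ∧ eval x h ∈ U (eval z h) := by
    rw [Filter.eventually_all_finset]
    intro z hz
    rw [← hnd z hz]
    have : (fun x : ι → ℝ => eval x h) ⁻¹' U (eval z h) ∈ nhds z :=
      hcont.continuousAt.preimage_mem_nhds ((hU _).2.mem_nhds (hU _).1)
    filter_upwards [Filter.image_mem_map this] with y hy
    obtain ⟨x, hx, rfl⟩ := hy
    exact ⟨x, rfl, hx⟩
  have hcoef : ∀ a : Fin (A + 1), (∑ β : ι → Fin (A + 1),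
      monomial (Finsupp.equivFunOnFinite.symm fun i => (β i : ℕ)) (c (a, β)) :
        MvPolynomial ι ℝ) = 0 := by
    intro a
    refine eq_zero_of_eventually_eval_eq_zero (x := 0) ?_
    filter_upwards [hev] with y hy
    choose! g hg1 hg2 using hy
    have hroots : ∀ z ∈ Z, ∑ a : Fin (A + 1), (∑ β : ι → Fin (A + 1),
        c (a, β) * ∏ i, y i ^ (β i : ℕ)) * (eval (g z) h) ^ (a : ℕ) = 0 := by
      intro z hz
      rw [← hrel (g z)]
      simp only [← congrFun (hg1 z hz)]
    have hginj : Set.InjOn (fun z => eval (g z) h) Z := by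
      intro z hz z' hz' he
      by_contra hne
      have h1 := hdisj (Set.mem_image_of_mem _ hz) (Set.mem_image_of_mem _ hz')
        (fun h' => hne (hinj hz hz' h'))
      exact Set.disjoint_left.1 h1 (hg2 z hz) (by
        have := hg2 z' hz'
        simp only at he
        rwa [← he] at this)
    have hp := Polynomial.eq_zero_of_natDegree_lt_card_of_eval_eq_zero'
      (∑ a : Fin (A + 1), Polynomial.C (∑ β : ι → Fin (A + 1),
        c (a, β) * ∏ i, y i ^ (β i : ℕ)) * Polynomial.X ^ (a : ℕ))
      (Z.image fun z => eval (g z) h) (by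
        intro r hr
        obtain ⟨z, hz, rfl⟩ := Finset.mem_image.1 hr
        simpa [Polynomial.eval_finsetSum, Polynomial.eval_prod] using hroots z hz) (by
        rw [Finset.card_image_of_injOn hginj]
        refine lt_of_le_of_lt ?_ hlt
        refine Polynomial.natDegree_sum_le_of_forall_le _ _ fun a _ => ?_
        exact (Polynomial.natDegree_C_mul_X_pow_le _ _).trans (Nat.lt_succ_iff.1 a.2))
    have hpa := congrArg (fun p => Polynomial.coeff p (a : ℕ)) hp
    simp only [Polynomial.finsetSum_coeff, Polynomial.coeff_C_mul, Polynomial.coeff_X_pow,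
      Polynomial.coeff_zero, Fin.val_inj, mul_ite, mul_one, mul_zero, Finset.sum_ite_eq,
      Finset.mem_univ, if_true] at hpa
    rw [map_sum, ← hpa]
    refine Finset.sum_congr rfl fun β _ => ?_
    rw [eval_monomial, Finsupp.prod_fintype _ _ (by simp)]
    simp
  have := congrArg (coeff (Finsupp.equivFunOnFinite.symm fun i => (s₀.2 i : ℕ))) (hcoef s₀.1)
  rw [coeff_sum, Finset.sum_eq_single s₀.2] at this
  · simp at this
    exact hs₀ this
  · intro β _ hβ
    rw [coeff_monomial, if_neg]
    intro he
    refine hβ (_root_.funext fun i => Fin.ext ?_)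
    exact congrFun (Finsupp.equivFunOnFinite.symm.injective he) i
  · simp

@[simp]
theorem differential_single {ι : Type*} [Fintype ι] [DecidableEq ι] (p : MvPolynomial ι ℝ)
    (x : ι → ℝ) (i : ι) : differential p x (Pi.single i 1) = eval x (pderiv i p) := by
  simp [differential, Pi.single_apply]

/-- The gradient map of a polynomial. -/
noncomputable def gradient {ι : Type*} (W : MvPolynomial ι ℝ) (x : ι → ℝ) : ι → ℝ :=
  fun i => eval x (pderiv i W)

theorem hasStrictFDerivAt_gradient {ι : Type*} [Fintype ι] (W : MvPolynomial ι ℝ) (x : ι → ℝ) :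
    HasStrictFDerivAt (gradient W)
      (ContinuousLinearMap.pi fun i => differential (pderiv i W) x) x :=
  hasStrictFDerivAt_pi.2 fun i => hasStrictFDerivAt_eval (pderiv i W) x

/-- Sard's theorem for the gradient: almost every vector is a regular value. -/
theorem dense_regular_values_gradient {ι : Type*} [Fintype ι] (W : MvPolynomial ι ℝ) :
    Dense {a : ι → ℝ | ∀ x, gradient W x = a → Filter.map (gradient W) (nhds x) = nhds a} := by
  have h0 := MeasureTheory.addHaar_image_eq_zero_of_det_fderivWithin_eq_zero
    (MeasureTheory.volume : MeasureTheory.Measure (ι → ℝ)) (f := gradient W)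
    (f' := fun x => ContinuousLinearMap.pi fun i => differential (pderiv i W) x)
    (s := {x | (ContinuousLinearMap.pi fun i => differential (pderiv i W) x).det = 0})
    (fun x _ => (hasStrictFDerivAt_gradient W x).hasFDerivAt.hasFDerivWithinAt)
    (fun x hx => hx)
  refine (MeasureTheory.Measure.dense_of_ae (MeasureTheory.measure_eq_zero_iff_ae_notMem.1 h0)).mono
    fun a ha x hx => ?_
  have hdet : (ContinuousLinearMap.pi fun i => differential (pderiv i W) x).det ≠ 0 :=
    fun h => ha ⟨x, h, hx⟩
  subst hx
  have := hasStrictFDerivAt_gradient W x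
  rw [← ContinuousLinearMap.coe_toContinuousLinearEquivOfDetNeZero _ hdet] at this
  exact this.map_nhds_eq_of_equiv

/-- A family of closed sets whose traces on the complement of a hypersurface are nonempty,
open and pairwise disjoint has cardinality polynomially bounded in the degree. -/
theorem card_cells_le {ι J : Type*} [Fintype ι] [Fintype J] (P : MvPolynomial ι ℝ) (E : ℕ)
    (hE : P.totalDegree ≤ E) (K : J → Set (ι → ℝ)) (hclosed : ∀ j, IsClosed (K j))
    (hne : ∀ j, ∃ p ∈ K j, eval p P ≠ 0)
    (hnhds : ∀ j, ∀ z ∈ K j, eval z P ≠ 0 → K j ∈ nhds z)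
    (hdisj : ∀ j j' z, z ∈ K j → z ∈ K j' → eval z P ≠ 0 → j = j') :
    Fintype.card J ≤ ((2 * E + 2) * Fintype.card ι + 1) ^ Fintype.card ι := by
  classical
  choose p hpK hpP using hne
  obtain ⟨R, hR1, hR⟩ : ∃ R : ℝ, 1 ≤ R ∧ ∀ j, ∑ i, p j i ^ 2 < R := by
    refine ⟨1 + ∑ j, ∑ i, p j i ^ 2, ?_, fun j => ?_⟩
    · have : 0 ≤ ∑ j, ∑ i, p j i ^ 2 := by positivity
      linarith
    · have := Finset.single_le_sum (f := fun j => ∑ i, p j i ^ 2)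
        (fun j _ => by positivity) (Finset.mem_univ j)
      linarith
  set W : MvPolynomial ι ℝ := P ^ 2 * (C R - ∑ i, X i ^ 2) with hW
  have hWeval : ∀ x : ι → ℝ, eval x W = eval x P ^ 2 * (R - ∑ i, x i ^ 2) := by
    intro x; simp [hW]
  have hWdeg : W.totalDegree ≤ 2 * E + 2 := by
    refine (totalDegree_mul _ _).trans (add_le_add ?_ ?_)
    · exact (totalDegree_pow _ _).trans (Nat.mul_le_mul le_rfl hE)
    · refine (totalDegree_sub _ _).trans (max_le (by simp) ?_)
      refine (totalDegree_finsetSum _ _).trans (Finset.sup_le fun i _ => ?_)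
      exact (totalDegree_pow _ _).trans (by simp)
  have hWpos : ∀ j, 0 < eval (p j) W := fun j => by
    rw [hWeval]
    exact mul_pos (by have := hpP j; positivity) (sub_pos.2 (hR j))
  obtain ⟨a, hareg, ha⟩ : ∃ a : ι → ℝ,
      (∀ x, gradient W x = a → Filter.map (gradient W) (nhds x) = nhds a) ∧
      ∀ j, 2 * (Fintype.card ι * R * ‖a‖) < eval (p j) W := by
    have hev : ∀ᶠ a : ι → ℝ in nhds 0, ∀ j, 2 * (Fintype.card ι * R * ‖a‖) < eval (p j) W := by
      rw [Filter.eventually_all]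
      intro j
      have hc : Continuous fun a : ι → ℝ => 2 * (Fintype.card ι * R * ‖a‖) := by fun_prop
      refine hc.continuousAt.eventually_lt continuousAt_const ?_
      simpa using hWpos j
    obtain ⟨a, ha1, ha2⟩ := (dense_regular_values_gradient W).inter_nhds_nonempty hev
    exact ⟨a, ha1, ha2⟩
  set G : MvPolynomial ι ℝ := W - ∑ i, C (a i) * X i with hG
  have hGeval : ∀ x : ι → ℝ, eval x G = eval x W - ∑ i, a i * x i := by
    intro x; simp [hG]
  have hlin : ∀ x : ι → ℝ, ∑ i, x i ^ 2 ≤ R → |∑ i, a i * x i| ≤ Fintype.card ι * R * ‖a‖ := by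
    intro x hx
    refine (Finset.abs_sum_le_sum_abs _ _).trans ?_
    rw [mul_assoc, ← nsmul_eq_mul]
    refine Finset.sum_le_card_nsmul _ _ _ fun i _ => ?_
    rw [abs_mul, mul_comm]
    have h1 : x i ^ 2 ≤ R :=
      (Finset.single_le_sum (f := fun i => x i ^ 2) (fun i _ => sq_nonneg _)
        (Finset.mem_univ i)).trans hx
    have h2 : |x i| ≤ R := abs_le_of_sq_le_sq (by nlinarith) (by linarith)
    exact mul_le_mul h2 (by simpa using norm_le_pi_norm a i) (abs_nonneg _) (by linarith)
  have hball : IsCompact {x : ι → ℝ | ∑ i, x i ^ 2 ≤ R} := by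
    refine Metric.isCompact_of_isClosed_isBounded
      (isClosed_le (by fun_prop) continuous_const) ?_
    refine (Metric.isBounded_closedBall (x := (0 : ι → ℝ)) (r := R)).subset fun x hx => ?_
    rw [mem_closedBall_zero_iff, pi_norm_le_iff_of_nonneg (by linarith)]
    intro i
    have h1 : x i ^ 2 ≤ R :=
      (Finset.single_le_sum (f := fun i => x i ^ 2) (fun i _ => sq_nonneg _)
        (Finset.mem_univ i)).trans hx
    exact abs_le_of_sq_le_sq (by nlinarith) (by linarith)
  have hmax : ∀ j, ∃ z ∈ K j, eval z P ≠ 0 ∧ gradient W z = a := by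
    intro j
    obtain ⟨z, ⟨hzK, hzR⟩, hz⟩ := (hball.inter_left (hclosed j)).exists_isMaxOn
      ⟨p j, hpK j, (hR j).le⟩ (f := fun x => eval x G) (MvPolynomial.continuous_eval G).continuousOn
    have hWz : 0 < eval z W := by
      have h1 : eval (p j) G ≤ eval z G := hz ⟨hpK j, (hR j).le⟩
      rw [hGeval, hGeval] at h1
      have h2 := abs_le.1 (hlin z hzR)
      have h3 := abs_le.1 (hlin (p j) (hR j).le)
      linarith [ha j, h2.1, h3.2]
    rw [hWeval] at hWz
    have hzP : eval z P ≠ 0 := by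
      intro h0
      simp [h0] at hWz
    have hzR' : ∑ i, z i ^ 2 < R := by
      have := pos_of_mul_pos_right hWz (sq_nonneg _)
      linarith
    refine ⟨z, hzK, hzP, ?_⟩
    have hloc : IsLocalMax (fun x => eval x G) z := by
      refine hz.isLocalMax (Filter.inter_mem (hnhds j z hzK hzP) ?_)
      have hc : Continuous fun x : ι → ℝ => ∑ i, x i ^ 2 := by fun_prop
      filter_upwards [hc.continuousAt.eventually_lt continuousAt_const hzR'] with x hx
      exact le_of_lt hx
    have hd := hloc.hasFDerivAt_eq_zero (hasStrictFDerivAt_eval G z).hasFDerivAt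
    ext i
    have hi := congrArg (fun φ => φ (Pi.single i 1)) hd
    simp only [differential_single] at hi
    rw [hG] at hi
    simp [pderiv_X, Pi.single_apply, apply_ite, sub_eq_zero] at hi
    exact hi
  choose z hzK hzP hza using hmax
  have hzinj : Function.Injective z := fun j j' h =>
    hdisj j j' (z j) (hzK j) (h ▸ hzK j') (hzP j)
  have := card_nondegenerate_zeros_le (fun i => pderiv i W - C (a i)) (2 * E + 2)
    (fun i => (totalDegree_sub _ _).trans
      (max_le ((totalDegree_pderiv_le _ _).trans hWdeg) (by simp)))
    (Finset.univ.image z)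
    (by
      intro x hx
      obtain ⟨j, -, rfl⟩ := Finset.mem_image.1 hx
      have h1 := hareg _ (hza j)
      have h2 : (fun (x : ι → ℝ) i => eval x (pderiv i W - C (a i))) =
          (fun y => y - a) ∘ gradient W := by
        ext x i; simp [gradient]
      rw [h2, ← Filter.map_map, h1]
      simp)
  rwa [Finset.card_image_of_injective _ hzinj, Finset.card_univ] at this

theorem totalDegree_aeval_le {κ ι : Type*} (Q : MvPolynomial κ ℝ)
    (q : κ → MvPolynomial ι ℝ) (m : ℕ) (hq : ∀ j, (q j).totalDegree ≤ m) :
    (aeval q Q).totalDegree ≤ Q.totalDegree * m := by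
  rw [aeval_def, eval₂_eq]
  refine (totalDegree_finsetSum _ _).trans (Finset.sup_le fun n hn => ?_)
  refine (totalDegree_mul _ _).trans ?_
  rw [algebraMap_eq, totalDegree_C, zero_add]
  refine (totalDegree_finsetProd _ _).trans ?_
  refine le_trans ?_ (Nat.mul_le_mul (le_totalDegree hn) le_rfl)
  rw [Finsupp.sum, Finset.sum_mul]
  exact Finset.sum_le_sum fun j _ => (totalDegree_pow _ _).trans (Nat.mul_le_mul le_rfl (hq j))

theorem sum_units_mul_pow (t : ℝ) (m : ℕ) :
    ∑ ε : ℤˣ, (((ε : ℤ) : ℝ) * t) ^ m = if Even m then 2 * (t ^ 2) ^ (m / 2) else 0 := by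
  rw [Fintype.sum_eq_add (1 : ℤˣ) (-1) (by decide) (by
    intro x hx
    rcases Int.units_eq_one_or x with h | h
    · exact absurd h hx.1
    · exact absurd h hx.2)]
  split_ifs with h
  · obtain ⟨r, rfl⟩ := h
    have : (r + r) / 2 = r := by omega
    rw [this]
    simp [← two_mul, pow_mul]
  · rw [Nat.not_even_iff_odd] at h
    simp [h.neg_pow]

/-- Averaging a polynomial over all sign changes gives a polynomial in the squares. -/
theorem exists_eval_sq_eq_sum_signs {κ : Type*} [Fintype κ] [DecidableEq κ] (p : MvPolynomial κ ℝ) :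
    ∃ Q : MvPolynomial κ ℝ, ∀ t : κ → ℝ,
      eval (fun j => t j ^ 2) Q = ∑ s : κ → ℤˣ, eval (fun j => ((s j : ℤ) : ℝ) * t j) p := by
  induction p using MvPolynomial.induction_on' with
  | monomial m c =>
    refine ⟨C c * ∏ j, if Even (m j) then C 2 * X j ^ (m j / 2) else 0, fun t => ?_⟩
    have h1 : ∀ s : κ → ℤˣ, eval (fun j => ((s j : ℤ) : ℝ) * t j) (monomial m c) =
        c * ∏ j, (((s j : ℤ) : ℝ) * t j) ^ m j := fun s => by
      rw [eval_monomial, Finsupp.prod_fintype _ _ (by simp)]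
    simp only [h1, ← Finset.mul_sum]
    rw [map_mul, eval_C, map_prod]
    congr 1
    have := (Fintype.prod_sum (fun (j : κ) (ε : ℤˣ) => (((ε : ℤ) : ℝ) * t j) ^ m j))
    rw [← this]
    refine Finset.prod_congr rfl fun j _ => ?_
    rw [sum_units_mul_pow]
    split_ifs <;> simp
  | add p q hp hq =>
    obtain ⟨Q, hQ⟩ := hp
    obtain ⟨Q', hQ'⟩ := hq
    refine ⟨Q + Q', fun t => ?_⟩
    simp [hQ, hQ', Finset.sum_add_distrib]

/-- The product of all signed sums of the variables is a polynomial in their squares. -/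
theorem exists_eval_sq_eq_prod_signed_sums (κ : Type*) [Fintype κ] [DecidableEq κ] :
    ∃ Q : MvPolynomial κ ℝ, ∀ t : κ → ℝ,
      eval (fun j => t j ^ 2) Q = ∏ s : κ → ℤˣ, ∑ j, ((s j : ℤ) : ℝ) * t j := by
  obtain ⟨Q, hQ⟩ := exists_eval_sq_eq_sum_signs
    (∏ s : κ → ℤˣ, ∑ j, C ((s j : ℤ) : ℝ) * X j : MvPolynomial κ ℝ)
  refine ⟨C ((Fintype.card (κ → ℤˣ) : ℝ)⁻¹) * Q, fun t => ?_⟩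
  have hcard : (Fintype.card (κ → ℤˣ) : ℝ) ≠ 0 := by
    exact_mod_cast Fintype.card_ne_zero
  rw [map_mul, eval_C, hQ, inv_mul_eq_iff_eq_mul₀ hcard, ← nsmul_eq_mul,
    ← Finset.card_univ, ← Finset.sum_const]
  refine Finset.sum_congr rfl fun s _ => ?_
  rw [map_prod, ← Equiv.prod_comp (Equiv.mulLeft s) (fun s' : κ → ℤˣ => ∑ j, ((s' j : ℤ) : ℝ) * t j)]
  refine Finset.prod_congr rfl fun s' _ => ?_
  simp only [map_sum, map_mul, eval_C, eval_X, Equiv.coe_mulLeft, Pi.mul_apply]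
  refine Finset.sum_congr rfl fun j _ => ?_
  push_cast
  ring

end MvPolynomial

/-- The family of `k` points of `ℝ^d` with the given coordinates. -/
noncomputable def pointsOfCoords {d k : ℕ} (v : Fin k × Fin d → ℝ) (i : Fin k) :
    EuclideanSpace ℝ (Fin d) :=
  WithLp.toLp 2 fun j => v (i, j)

/-- The sum of the distances from `x` to the points of an indexed family. -/
noncomputable def famDist {d k : ℕ} (f : Fin k → EuclideanSpace ℝ (Fin d))
    (x : EuclideanSpace ℝ (Fin d)) : ℝ :=
  ∑ i, dist x (f i)

theorem continuous_famDist_pointsOfCoords {d k : ℕ} (x : EuclideanSpace ℝ (Fin d)) :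
    Continuous fun v : Fin k × Fin d → ℝ => famDist (pointsOfCoords v) x := by
  unfold famDist pointsOfCoords
  refine continuous_finsetSum _ fun i _ => continuous_const.dist ?_
  exact (PiLp.continuous_toLp 2 _).comp (by fun_prop)

theorem exists_unit_orthogonal {d : ℕ} (hd : 2 ≤ d) (w : EuclideanSpace ℝ (Fin d)) :
    ∃ u : EuclideanSpace ℝ (Fin d), ‖u‖ = 1 ∧ inner ℝ w u = 0 := by
  have hfr : Module.finrank ℝ (EuclideanSpace ℝ (Fin d)) = d := by simp
  have : ∃ u ∈ (ℝ ∙ w)ᗮ, u ≠ 0 := by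
    rw [← Submodule.ne_bot_iff, Ne, Submodule.orthogonal_eq_bot_iff]
    intro h
    have h1 := finrank_span_le_card (R := ℝ) ({w} : Set (EuclideanSpace ℝ (Fin d)))
    rw [h, finrank_top, hfr] at h1
    simp at h1
    omega
  obtain ⟨u, hu, hu0⟩ := this
  refine ⟨‖u‖⁻¹ • u, norm_smul_inv_norm hu0, ?_⟩
  rw [inner_smul_right, Submodule.mem_orthogonal_singleton_iff_inner_right.1 hu, mul_zero]

theorem exists_signed_dist_notMem {d : ℕ} (hd : 2 ≤ d) {x y : EuclideanSpace ℝ (Fin d)}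
    (hxy : x ≠ y) (T : Finset ℝ) :
    ∃ v : EuclideanSpace ℝ (Fin d), ∀ ε ε' : ℤˣ,
      ((ε : ℤ) : ℝ) * dist x v + ((ε' : ℤ) : ℝ) * dist y v ∉ T := by
  classical
  obtain ⟨u, hu1, hu⟩ := exists_unit_orthogonal hd (y - x)
  set L := ‖y - x‖ with hL
  have hL0 : L ≠ 0 := norm_ne_zero_iff.2 (sub_ne_zero.2 hxy.symm)
  obtain ⟨t, ht0, ht⟩ := (Set.Ici_infinite (0 : ℝ)).exists_notMem_finset
    ((T ×ˢ (Finset.univ : Finset ℤˣ)).image fun p => (p.1 ^ 2 - L ^ 2) / (2 * ((p.2 : ℤ) : ℝ) * p.1))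
  have ha : dist x (x + t • u) = t := by
    rw [dist_self_add_right, norm_smul, hu1, mul_one, Real.norm_of_nonneg ht0]
  have hb : dist y (x + t • u) ^ 2 = L ^ 2 + t ^ 2 := by
    rw [dist_eq_norm, ← sub_sub, @norm_sub_sq_real, inner_smul_right, hu, norm_smul, hu1, ← hL]
    simp
  refine ⟨x + t • u, fun ε ε' hmem => ht ?_⟩
  rw [ha] at hmem
  set b := dist y (x + t • u)
  set τ := ((ε : ℤ) : ℝ) * t + ((ε' : ℤ) : ℝ) * b with hτ
  have hsq : ∀ e : ℤˣ, ((e : ℤ) : ℝ) ^ 2 = 1 := fun e => by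
    rcases Int.units_eq_one_or e with h | h <;> simp [h]
  have hkey : τ ^ 2 - L ^ 2 = t * (2 * ((ε : ℤ) : ℝ) * τ) := by
    have h1 : (((ε' : ℤ) : ℝ) * b) ^ 2 = (τ - ((ε : ℤ) : ℝ) * t) ^ 2 := by rw [hτ]; ring
    rw [mul_pow, hsq, one_mul, hb] at h1
    have h2 := hsq ε
    linear_combination -h1 - t ^ 2 * h2
  have hτ0 : τ ≠ 0 := by
    intro h0
    rw [h0] at hkey
    have : L ^ 2 = 0 := by linarith
    exact hL0 (pow_eq_zero_iff (two_ne_zero) |>.1 this)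
  have hε0 : ((ε : ℤ) : ℝ) ≠ 0 := fun h0 => by
    have := hsq ε
    rw [h0] at this
    norm_num at this
  refine Finset.mem_image.2 ⟨(τ, ε), Finset.mem_product.2 ⟨hmem, Finset.mem_univ _⟩, ?_⟩
  simp only
  rw [hkey, mul_div_assoc, div_self (by positivity), mul_one]

open MvPolynomial in
/-- The hypersurface `D_V(x) = D_V(y)` lies in the zero set of a nonzero polynomial of degree
bounded independently of `x` and `y`. -/
theorem exists_polynomial_of_famDist_eq {d k : ℕ} (hd : 2 ≤ d) (hk : 1 ≤ k) :
    ∃ e : ℕ, ∀ x y : EuclideanSpace ℝ (Fin d), x ≠ y →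
      ∃ P : MvPolynomial (Fin k × Fin d) ℝ, P ≠ 0 ∧ P.totalDegree ≤ e ∧
        ∀ v, famDist (pointsOfCoords v) x = famDist (pointsOfCoords v) y → eval v P = 0 := by
  classical
  obtain ⟨Q, hQ⟩ := exists_eval_sq_eq_prod_signed_sums (Fin k ⊕ Fin k)
  refine ⟨Q.totalDegree * 2, fun x y hxy => ?_⟩
  let q : EuclideanSpace ℝ (Fin d) → Fin k → MvPolynomial (Fin k × Fin d) ℝ := fun z i =>
    ∑ j, (C (z j) - X (i, j)) ^ 2
  have hq : ∀ z i, (q z i).totalDegree ≤ 2 := fun z i => by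
    refine (totalDegree_finsetSum _ _).trans (Finset.sup_le fun j _ => ?_)
    refine (totalDegree_pow _ _).trans ?_
    have : (C (z j) - X (i, j) : MvPolynomial (Fin k × Fin d) ℝ).totalDegree ≤ 1 :=
      (totalDegree_sub _ _).trans (by simp)
    omega
  have hqe : ∀ z i v, eval v (q z i) = dist z (pointsOfCoords v i) ^ 2 := fun z i v => by
    simp [q, EuclideanSpace.dist_eq, pointsOfCoords, Real.sq_sqrt, Finset.sum_nonneg, sq_nonneg,
      Real.dist_eq, sq_abs]
  have hPe : ∀ v, eval v (aeval (Sum.elim (q x) (q y)) Q) = ∏ s : Fin k ⊕ Fin k → ℤˣ,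
      ((∑ i, ((s (Sum.inl i) : ℤ) : ℝ) * dist x (pointsOfCoords v i)) +
        ∑ i, ((s (Sum.inr i) : ℤ) : ℝ) * dist y (pointsOfCoords v i)) := fun v => by
    have := hQ (Sum.elim (fun i => dist x (pointsOfCoords v i)) fun i => dist y (pointsOfCoords v i))
    simp only [Fintype.sum_sum_type, Sum.elim_inl, Sum.elim_inr] at this
    rw [← this]
    refine (eval₂Hom_bind₁ (RingHom.id ℝ) v (Sum.elim (q x) (q y)) Q).trans ?_
    refine congrArg (fun g => eval g Q) (_root_.funext fun j => ?_)
    rcases j with i | i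
    · exact hqe x i v
    · exact hqe y i v
  refine ⟨aeval (Sum.elim (q x) (q y)) Q, ?_, totalDegree_aeval_le _ _ _ ?_, ?_⟩
  · intro h0
    let i₀ : Fin k := ⟨0, hk⟩
    obtain ⟨p, hp⟩ := exists_signed_dist_notMem hd hxy
      (Finset.univ.image fun s : Fin k ⊕ Fin k → ℤˣ =>
        -((∑ i ∈ Finset.univ.erase i₀, ((s (Sum.inl i) : ℤ) : ℝ) * dist x x) +
          ∑ i ∈ Finset.univ.erase i₀, ((s (Sum.inr i) : ℤ) : ℝ) * dist y x))
    let v : Fin k × Fin d → ℝ := fun ij => if ij.1 = i₀ then p ij.2 else x ij.2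
    have hv0 : pointsOfCoords v i₀ = p := by
      ext j; simp [pointsOfCoords, v]
    have hv : ∀ i ∈ Finset.univ.erase i₀, pointsOfCoords v i = x := fun i hi => by
      ext j; simp [pointsOfCoords, v, Finset.ne_of_mem_erase hi]
    have h1 := hPe v
    rw [h0, map_zero, eq_comm, Finset.prod_eq_zero_iff] at h1
    obtain ⟨s, -, hs⟩ := h1
    rw [← Finset.add_sum_erase _ _ (Finset.mem_univ i₀),
      ← Finset.add_sum_erase _ (fun i => ((s (Sum.inr i) : ℤ) : ℝ) * _) (Finset.mem_univ i₀),
      hv0] at hs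
    refine hp (s (Sum.inl i₀)) (s (Sum.inr i₀))
      (Finset.mem_image.2 ⟨s, Finset.mem_univ _, ?_⟩)
    have e1 : ∀ (z : EuclideanSpace ℝ (Fin d)) (g : Fin k → ℝ), ∑ i ∈ Finset.univ.erase i₀,
        g i * dist z (pointsOfCoords v i) = ∑ i ∈ Finset.univ.erase i₀, g i * dist z x :=
      fun z g => Finset.sum_congr rfl fun i hi => by rw [hv i hi]
    rw [e1 x (fun i => ((s (Sum.inl i) : ℤ) : ℝ)), e1 y (fun i => ((s (Sum.inr i) : ℤ) : ℝ))] at hs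
    linarith
  · rintro (i | i) <;> simp [hq]
  · intro v hv
    rw [hPe, Finset.prod_eq_zero (Finset.mem_univ (Sum.elim (fun _ => 1) fun _ => -1))]
    simpa [famDist, ← sub_eq_add_neg, sub_eq_zero] using hv

open MvPolynomial in
/-- Outside the zero set of a suitable nonzero polynomial of degree `O(n ^ 2)`, the vantage points
distinguish the points of an `n`-element set. -/
theorem exists_polynomial_injOn {d k : ℕ} (hd : 2 ≤ d) (hk : 1 ≤ k) :
    ∃ e : ℕ, ∀ C : Finset (EuclideanSpace ℝ (Fin d)),
      ∃ P : MvPolynomial (Fin k × Fin d) ℝ, P ≠ 0 ∧ P.totalDegree ≤ C.card ^ 2 * e ∧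
        ∀ v, eval v P ≠ 0 → Set.InjOn (famDist (pointsOfCoords v)) C := by
  classical
  obtain ⟨e, he⟩ := exists_polynomial_of_famDist_eq hd hk
  choose! P hP0 hPdeg hP using he
  refine ⟨e, fun C => ⟨∏ p ∈ C.offDiag, P p.1 p.2, ?_, ?_, fun v hv x hx y hy hxy => ?_⟩⟩
  · exact Finset.prod_ne_zero_iff.2 fun p hp => hP0 _ _ (Finset.mem_offDiag.1 hp).2.2
  · refine (totalDegree_finsetProd _ _).trans ?_
    refine (Finset.sum_le_card_nsmul _ _ e fun p hp =>
      hPdeg _ _ (Finset.mem_offDiag.1 hp).2.2).trans ?_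
    rw [smul_eq_mul, Finset.offDiag_card, sq]
    exact Nat.mul_le_mul (Nat.sub_le _ _) le_rfl
  · by_contra hne
    refine hv ?_
    rw [map_prod]
    exact Finset.prod_eq_zero (i := (x, y)) (Finset.mem_offDiag.2 ⟨hx, hy, hne⟩) (hP _ _ hne v hxy)

theorem exists_pointsOfCoords_of_card_eq {d k : ℕ} (V : Multiset (EuclideanSpace ℝ (Fin d)))
    (hV : Multiset.card V = k) :
    ∃ v : Fin k × Fin d → ℝ, sumDist V = famDist (pointsOfCoords v) := by
  subst hV
  induction V using Quotient.inductionOn with | _ l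
  refine ⟨fun p => l.get p.1 p.2, ?_⟩
  ext x
  change ((l : Multiset (EuclideanSpace ℝ (Fin d))).map _).sum = ∑ i : Fin l.length, dist x (l.get i)
  rw [Multiset.map_coe, Multiset.sum_coe, ← List.sum_ofFn]
  congr 1
  conv_lhs => rw [← List.ofFn_get l, List.map_ofFn]
  rfl

theorem exists_multiset_sumDist_eq {d k : ℕ} (f : Fin k → EuclideanSpace ℝ (Fin d)) :
    ∃ V : Multiset (EuclideanSpace ℝ (Fin d)), Multiset.card V = k ∧ sumDist V = famDist f :=
  ⟨Finset.univ.val.map f, by simp, by ext x; simp [sumDist, famDist, List.sum_ofFn]⟩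

theorem finite_psiSet {d : ℕ} (k n : ℕ) (C : Finset (EuclideanSpace ℝ (Fin d))) :
    (PsiSet k n C).Finite :=
  (Set.Finite.pi' (ι := Fin n) (t := fun _ => (C : Set (EuclideanSpace ℝ (Fin d))))
    fun _ => C.finite_toSet).subset fun _ hσ => hσ.2.1

theorem range_eq_of_mem_psiSet {d k : ℕ} {C : Finset (EuclideanSpace ℝ (Fin d))}
    {σ : Fin C.card → EuclideanSpace ℝ (Fin d)} (hσ : σ ∈ PsiSet k C.card C) :
    Set.range σ = C := by
  classical
  have : Finset.univ.image σ = C := Finset.eq_of_subset_of_card_le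
    (Finset.image_subset_iff.2 fun i _ => hσ.2.1 i)
    (by simp [Finset.card_image_of_injective _ hσ.1])
  simpa using congrArg (fun s : Finset _ => (s : Set (EuclideanSpace ℝ (Fin d)))) this

theorem psiCount_le {d k : ℕ} (hd : 2 ≤ d) (hk : 1 ≤ k) :
    ∃ e : ℕ, ∀ C : Finset (EuclideanSpace ℝ (Fin d)),
      psiCount k C ≤ ((2 * (C.card ^ 2 * e) + 2) * (k * d) + 1) ^ (k * d) := by
  obtain ⟨e, he⟩ := exists_polynomial_injOn hd hk
  refine ⟨e, fun C => ?_⟩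
  obtain ⟨P, hP0, hPdeg, hP⟩ := he C
  have := (finite_psiSet k C.card C).fintype
  have hcont : ∀ x, Continuous fun v : Fin k × Fin d → ℝ => famDist (pointsOfCoords v) x :=
    continuous_famDist_pointsOfCoords
  have hopen : ∀ (σ : Fin C.card → EuclideanSpace ℝ (Fin d)) (z : Fin k × Fin d → ℝ),
      (StrictMono fun i => famDist (pointsOfCoords z) (σ i)) →
      ∀ᶠ v in nhds z, StrictMono fun i => famDist (pointsOfCoords v) (σ i) := by
    intro σ z hz
    have h1 : ∀ᶠ v in nhds z, ∀ a b, a < b →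
        famDist (pointsOfCoords v) (σ a) < famDist (pointsOfCoords v) (σ b) := by
      simp only [Filter.eventually_all]
      intro a b hab
      exact (hcont _).continuousAt.eventually_lt (hcont _).continuousAt (hz hab)
    exact h1.mono fun v hv a b hab => hv a b hab
  have hstrict : ∀ σ ∈ PsiSet k C.card C, ∀ z,
      (Monotone fun i => famDist (pointsOfCoords z) (σ i)) → MvPolynomial.eval z P ≠ 0 →
      StrictMono fun i => famDist (pointsOfCoords z) (σ i) := by
    intro σ hσ z hz hzP
    refine hz.strictMono_of_injective fun a b hab => hσ.1 ?_
    exact hP z hzP (hσ.2.1 a) (hσ.2.1 b) hab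
  have key := MvPolynomial.card_cells_le P _ hPdeg
    (fun σ : PsiSet k C.card C => {z | Monotone fun i => famDist (pointsOfCoords z) (σ.1 i)})
    (fun σ => by
      simp only [Monotone, Set.ofPred_forall]
      exact isClosed_iInter fun a => isClosed_iInter fun b => isClosed_iInter fun _ =>
        isClosed_le (hcont _) (hcont _))
    (fun σ => by
      obtain ⟨V, hVk, -, hV⟩ := σ.2.2.2
      obtain ⟨z, hz⟩ := exists_pointsOfCoords_of_card_eq V hVk
      rw [hz] at hV
      by_contra! hcon
      refine hP0 (MvPolynomial.eq_zero_of_eventually_eval_eq_zero (x := z) ?_)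
      filter_upwards [hopen _ z hV] with v hv
      exact hcon v hv.monotone)
    (fun σ z hz hzP => by
      filter_upwards [hopen _ z (hstrict _ σ.2 z hz hzP)] with v hv
      exact hv.monotone)
    (fun σ σ' z hz hz' hzP => by
      have h1 := hstrict _ σ.2 z hz hzP
      have h2 := hstrict _ σ'.2 z hz' hzP
      have h3 : Set.range (fun i => famDist (pointsOfCoords z) (σ.1 i)) =
          Set.range (fun i => famDist (pointsOfCoords z) (σ'.1 i)) := by
        have h := (range_eq_of_mem_psiSet σ.2).trans (range_eq_of_mem_psiSet σ'.2).symm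
        exact (Set.range_comp (famDist (pointsOfCoords z)) _).trans
          ((congrArg (Set.image _) h).trans (Set.range_comp _ _).symm)
      have h4 := (StrictMono.range_inj h1 h2).1 h3
      ext1
      ext1 i
      exact hP z hzP (σ.2.2.1 i) (σ'.2.2.1 i) (congrFun h4 i))
  rw [psiCount, Nat.card_eq_fintype_card]
  simpa using key

/-- The vector `x / ‖x‖`, the gradient of the norm. -/
noncomputable def unitVec {d : ℕ} (x : EuclideanSpace ℝ (Fin d)) : EuclideanSpace ℝ (Fin d) :=
  ‖x‖⁻¹ • x

theorem inner_unitVec_self {d : ℕ} (x : EuclideanSpace ℝ (Fin d)) :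
    inner ℝ (unitVec x) x = ‖x‖ := by
  rw [unitVec, real_inner_smul_left, real_inner_self_eq_norm_sq]
  by_cases h : ‖x‖ = 0
  · simp [h]
  · field_simp

theorem norm_unitVec_le {d : ℕ} (x : EuclideanSpace ℝ (Fin d)) : ‖unitVec x‖ ≤ 1 := by
  rw [unitVec, norm_smul, norm_inv, norm_norm]
  exact inv_mul_le_one

theorem inner_unitVec_le {d : ℕ} (x y : EuclideanSpace ℝ (Fin d)) :
    inner ℝ (unitVec x) y ≤ ‖y‖ := by
  refine (real_inner_le_norm _ _).trans ?_
  exact mul_le_of_le_one_left (norm_nonneg _) (norm_unitVec_le x)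

theorem exists_unit_vectors_inner_ne {d : ℕ} (hd : 2 ≤ d) (g : EuclideanSpace ℝ (Fin d))
    {w : EuclideanSpace ℝ (Fin d)} (hw : w ≠ 0) :
    ∃ z z' : EuclideanSpace ℝ (Fin d), ‖z‖ = 1 ∧ ‖z'‖ = 1 ∧ 0 ≤ inner ℝ g z ∧ 0 ≤ inner ℝ g z' ∧
      inner ℝ z w ≠ inner ℝ z' w := by
  have hsign : ∀ u : EuclideanSpace ℝ (Fin d), ‖u‖ = 1 → ∃ z, ‖z‖ = 1 ∧ 0 ≤ inner ℝ g z ∧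
      (z = u ∨ z = -u) := by
    intro u hu
    rcases le_total 0 (inner ℝ g u) with h | h
    · exact ⟨u, hu, h, Or.inl rfl⟩
    · exact ⟨-u, by rwa [norm_neg], by rw [inner_neg_right]; linarith, Or.inr rfl⟩
  obtain ⟨u, hu1, hu⟩ := exists_unit_orthogonal hd w
  obtain ⟨z, hz1, hzg, hz⟩ := hsign (‖w‖⁻¹ • w) (norm_smul_inv_norm hw)
  obtain ⟨z', hz1', hzg', hz'⟩ := hsign u hu1
  refine ⟨z, z', hz1, hz1', hzg, hzg', ?_⟩
  have h1 : inner ℝ z' w = 0 := by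
    rw [real_inner_comm]
    rcases hz' with rfl | rfl <;> simp [hu]
  have h2 : inner ℝ (‖w‖⁻¹ • w) w ≠ 0 := by
    have := inner_unitVec_self w
    rw [unitVec] at this
    rw [this]
    exact norm_ne_zero_iff.2 hw
  rw [h1]
  rcases hz with rfl | rfl
  · exact h2
  · rw [inner_neg_left]
    exact neg_ne_zero.2 h2

theorem continuousAt_unitVec {d : ℕ} {x : EuclideanSpace ℝ (Fin d)} (hx : x ≠ 0) :
    ContinuousAt unitVec x :=
  (continuous_norm.continuousAt.inv₀ (norm_ne_zero_iff.2 hx)).smul continuousAt_id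

/-- The sum of distances grows at least linearly from a vantage point, in a direction making a
nonnegative angle with the gradient of the other distances. -/
theorem famDist_add_le_famDist {d k : ℕ} (f : Fin k → EuclideanSpace ℝ (Fin d)) (i : Fin k)
    {z : EuclideanSpace ℝ (Fin d)} (hz : ‖z‖ = 1)
    (hg : 0 ≤ inner ℝ (∑ j ∈ Finset.univ.erase i, unitVec (f i - f j)) z) {r : ℝ} (hr : 0 ≤ r) :
    famDist f (f i) + r ≤ famDist f (f i + r • z) := by
  unfold famDist
  rw [← Finset.add_sum_erase _ _ (Finset.mem_univ i),
    ← Finset.add_sum_erase _ (fun j => dist (f i + r • z) (f j)) (Finset.mem_univ i)]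
  have h1 : dist (f i + r • z) (f i) = r := by
    rw [dist_self_add_left, norm_smul, hz, mul_one, Real.norm_of_nonneg hr]
  have h2 : ∑ j ∈ Finset.univ.erase i, (dist (f i) (f j) + r * inner ℝ (unitVec (f i - f j)) z) ≤
      ∑ j ∈ Finset.univ.erase i, dist (f i + r • z) (f j) := by
    refine Finset.sum_le_sum fun j _ => ?_
    have := inner_unitVec_le (f i - f j) (f i + r • z - f j)
    rw [dist_eq_norm, dist_eq_norm]
    rw [show f i + r • z - f j = (f i - f j) + r • z by abel, inner_add_right, inner_unitVec_self,
      real_inner_smul_right] at this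
    rwa [show f i + r • z - f j = (f i - f j) + r • z by abel]
  rw [Finset.sum_add_distrib, ← Finset.mul_sum, ← sum_inner] at h2
  rw [h1, dist_self]
  have := mul_nonneg hr hg
  linarith

/-- Where the sum of distances exceeds its value at some point, its gradient does not vanish. -/
theorem exists_inner_gradient_eq_one {d k : ℕ} (f : Fin k → EuclideanSpace ℝ (Fin d))
    {a b : EuclideanSpace ℝ (Fin d)} (h : famDist f b < famDist f a) :
    ∃ α, ∑ i, inner ℝ (unitVec (a - f i)) α = (1 : ℝ) := by
  have h1 : famDist f a - famDist f b ≤ ∑ i, inner ℝ (unitVec (a - f i)) (a - b) := by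
    unfold famDist
    rw [← Finset.sum_sub_distrib]
    refine Finset.sum_le_sum fun i _ => ?_
    have := inner_unitVec_le (a - f i) (b - f i)
    rw [show a - b = (a - f i) - (b - f i) by abel, inner_sub_right, inner_unitVec_self,
      dist_eq_norm, dist_eq_norm]
    linarith
  set s := ∑ i, inner ℝ (unitVec (a - f i)) (a - b)
  have hs : s ≠ 0 := by intro h0; linarith
  refine ⟨s⁻¹ • (a - b), ?_⟩
  simp only [real_inner_smul_right, ← Finset.mul_sum]
  exact inv_mul_cancel₀ hs

theorem continuous_famDist {d k : ℕ} (f : Fin k → EuclideanSpace ℝ (Fin d)) :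
    Continuous (famDist f) := by
  unfold famDist
  fun_prop

open Filter Topology in
theorem tendsto_sum_inner_unitVec {d k : ℕ} {f : Fin k → EuclideanSpace ℝ (Fin d)}
    (hf : Function.Injective f) (w : Fin k → EuclideanSpace ℝ (Fin d)) (i : Fin k)
    {z : EuclideanSpace ℝ (Fin d)} (hz : ‖z‖ = 1) :
    Tendsto (fun r : ℝ => ∑ j, inner ℝ (unitVec (f i + r • z - f j)) (w j)) (𝓝[>] 0)
      (𝓝 (inner ℝ z (w i) + ∑ j ∈ Finset.univ.erase i, inner ℝ (unitVec (f i - f j)) (w j))) := by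
  simp only [← Finset.add_sum_erase _ (fun j => inner ℝ (unitVec (f i + _ • z - f j)) (w j))
    (Finset.mem_univ i)]
  refine Tendsto.add ?_ (tendsto_finsetSum _ fun j hj => ?_)
  · refine tendsto_const_nhds.congr' ?_
    filter_upwards [self_mem_nhdsWithin] with r hr
    have hr : 0 < r := hr
    rw [unitVec, add_sub_cancel_left, norm_smul, hz, mul_one, Real.norm_of_nonneg hr.le, smul_smul,
      inv_mul_cancel₀ hr.ne', one_smul]
  · have hne : f i - f j ≠ 0 := sub_ne_zero.2 fun h => Finset.ne_of_mem_erase hj (hf h.symm)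
    have h1 : ContinuousAt (fun r : ℝ => unitVec (f i + r • z - f j)) 0 := by
      refine ContinuousAt.comp (g := unitVec) ?_ (by fun_prop)
      simpa using continuousAt_unitVec hne
    have h2 : ContinuousAt (fun r : ℝ => inner ℝ (unitVec (f i + r • z - f j)) (w j)) 0 :=
      h1.inner continuousAt_const
    have := h2.tendsto
    simp only [zero_smul, add_zero] at this
    exact this.mono_left nhdsWithin_le_nhds

open Filter Topology in
theorem eventually_ray_ne {d k : ℕ} {f : Fin k → EuclideanSpace ℝ (Fin d)}
    (hf : Function.Injective f) (i : Fin k) {z : EuclideanSpace ℝ (Fin d)} (hz : ‖z‖ = 1) :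
    ∀ᶠ r : ℝ in 𝓝[>] 0, ∀ j, f i + r • z ≠ f j := by
  rw [eventually_all]
  intro j
  by_cases h : j = i
  · subst h
    filter_upwards [self_mem_nhdsWithin] with r hr h0
    have hr : 0 < r := hr
    rw [add_eq_left, smul_eq_zero] at h0
    rcases h0 with h0 | h0
    · exact hr.ne' h0
    · simp [h0] at hz
  · have hc : Continuous fun r : ℝ => f i + r • z := by fun_prop
    refine (hc.continuousAt.eventually_ne ?_).filter_mono nhdsWithin_le_nhds
    simpa using fun h' => h (hf h').symm

open Filter Topology in
/-- For any nonzero motion `w` of the vantage points `f`, there are two points at equal distance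
sum from `f` whose distance sums change at different rates along `w`. -/
theorem exists_pair_separating {d k : ℕ} (hd : 2 ≤ d) {f : Fin k → EuclideanSpace ℝ (Fin d)}
    (hf : Function.Injective f) {w : Fin k → EuclideanSpace ℝ (Fin d)} (hw : w ≠ 0) :
    ∃ a b, famDist f a = famDist f b ∧ (∀ i, a ≠ f i) ∧ (∀ i, b ≠ f i) ∧
      (∃ α, ∑ i, inner ℝ (unitVec (a - f i)) α = (1 : ℝ)) ∧
      (∃ β, ∑ i, inner ℝ (unitVec (b - f i)) β = (1 : ℝ)) ∧
      ∑ i, inner ℝ (unitVec (b - f i) - unitVec (a - f i)) (w i) ≠ (0 : ℝ) := by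
  obtain ⟨i, hi⟩ := Function.ne_iff.1 hw
  obtain ⟨z, z', hz, hz', hzg, hzg', hne⟩ := exists_unit_vectors_inner_ne hd
    (∑ j ∈ Finset.univ.erase i, unitVec (f i - f j)) hi
  have hK := tendsto_sum_inner_unitVec hf w i hz
  have hK' := tendsto_sum_inner_unitVec hf w i hz'
  have hev : ∀ᶠ p : ℝ × ℝ in 𝓝[>] 0 ×ˢ 𝓝[>] 0,
      ∑ j, inner ℝ (unitVec (f i + p.1 • z - f j)) (w j) ≠
        ∑ j, inner ℝ (unitVec (f i + p.2 • z' - f j)) (w j) :=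
    by
    have := ((hK.comp tendsto_fst).sub (hK'.comp tendsto_snd)).eventually_ne (b₂ := 0)
      (by simpa [sub_eq_zero] using hne)
    exact this.mono fun p hp => sub_ne_zero.1 hp
  obtain ⟨s, hs, s', hs', hss⟩ := Filter.mem_prod_iff.1 hev
  have hs2 := inter_mem hs (eventually_ray_ne hf i hz)
  have hs2' := inter_mem hs' (eventually_ray_ne hf i hz')
  obtain ⟨δ, hδ, hδs⟩ := mem_nhdsGT_iff_exists_Ioc_subset.1 hs2'
  have hδ : 0 < δ := hδ
  have hcont : Continuous fun r : ℝ => famDist f (f i + r • z) :=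
    (continuous_famDist f).comp (by fun_prop)
  have hcont' : Continuous fun r : ℝ => famDist f (f i + r • z') :=
    (continuous_famDist f).comp (by fun_prop)
  have hsmall : ∀ᶠ r : ℝ in 𝓝[>] 0, famDist f (f i + r • z) < famDist f (f i) + δ := by
    refine (hcont.continuousAt.eventually_lt continuousAt_const ?_).filter_mono nhdsWithin_le_nhds
    simpa using hδ
  obtain ⟨r, ⟨hrs, hrf⟩, hrδ, hr0⟩ := (((eventually_mem_set.2 hs2).and
    (hsmall.and self_mem_nhdsWithin))).exists
  have hr0 : 0 < r := hr0
  have hlow := famDist_add_le_famDist f i hz hzg hr0.le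
  have hhigh := famDist_add_le_famDist f i hz' hzg' hδ.le
  obtain ⟨r', ⟨hr'0, hr'δ⟩, hr'⟩ := intermediate_value_Icc hδ.le hcont'.continuousOn
    (show famDist f (f i + r • z) ∈ Set.Icc _ _ by
      simp only [zero_smul, add_zero]
      constructor <;> linarith)
  simp only at hr'
  have hr'pos : 0 < r' := by
    refine lt_of_le_of_ne hr'0 fun h => ?_
    rw [← h, zero_smul, add_zero] at hr'
    linarith
  obtain ⟨hr's, hr'f⟩ := hδs ⟨hr'pos, hr'δ⟩
  refine ⟨f i + r • z, f i + r' • z', hr'.symm, hrf, hr'f,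
    exists_inner_gradient_eq_one f (b := f i) (by linarith),
    exists_inner_gradient_eq_one f (b := f i) (by linarith), ?_⟩
  have := hss (Set.mk_mem_prod hrs hr's)
  simp only [inner_sub_left, Finset.sum_sub_distrib]
  exact sub_ne_zero.2 (Ne.symm this)

/-- A family of linear forms with no common zero contains `finrank` many independent ones. -/
theorem exists_surjective_of_forall_exists_ne_zero {M : Type*} [AddCommGroup M] [Module ℝ M]
    [FiniteDimensional ℝ M] (S : Set (Module.Dual ℝ M)) (hS : ∀ w ≠ 0, ∃ φ ∈ S, φ w ≠ 0) (n : ℕ)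
    (hn : Module.finrank ℝ M = n) :
    ∃ φ : Fin n → Module.Dual ℝ M, (∀ j, φ j ∈ S) ∧ ∀ τ : Fin n → ℝ, ∃ u, ∀ j, φ j u = τ j := by
  obtain ⟨b, hbS, hspan, hli⟩ := exists_linearIndependent ℝ S
  have hfin : Finite b := hli.finite
  have := Fintype.ofFinite b
  have hle : Fintype.card b ≤ n := by
    rw [← hn, ← Subspace.dual_finrank_eq]
    exact hli.fintype_card_le_finrank
  let Φ : M →ₗ[ℝ] (b → ℝ) := LinearMap.pi fun φ => φ.1
  have hinj : Function.Injective Φ := by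
    rw [← LinearMap.ker_eq_bot, LinearMap.ker_eq_bot']
    intro u hu
    by_contra hne
    obtain ⟨φ, hφ, hφu⟩ := hS u hne
    refine hφu ?_
    have h1 : Submodule.span ℝ S ≤ LinearMap.ker (Module.Dual.eval ℝ M u) := by
      rw [← hspan, Submodule.span_le]
      intro ψ hψ
      exact congrFun hu ⟨ψ, hψ⟩
    exact h1 (Submodule.subset_span hφ)
  have hge := LinearMap.finrank_le_finrank_of_injective hinj
  rw [hn, Module.finrank_fintype_fun_eq_card] at hge
  have hcard : Fintype.card b = n := le_antisymm hle hge
  have hsurj : Function.Surjective Φ :=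
    (LinearMap.injective_iff_surjective_of_finrank_eq_finrank
      (by rw [hn, Module.finrank_fintype_fun_eq_card, hcard])).1 hinj
  let e : Fin n ≃ b := (Fintype.equivFinOfCardEq hcard).symm
  refine ⟨fun j => (e j).1, fun j => hbS (e j).2, fun τ => ?_⟩
  obtain ⟨u, hu⟩ := hsurj fun φ => τ (e.symm φ)
  refine ⟨u, fun j => ?_⟩
  exact (congrFun hu (e j)).trans (by simp)

theorem exists_clusters {d k : ℕ} (hd : 2 ≤ d) :
    ∃ (f : Fin k → EuclideanSpace ℝ (Fin d)) (a b α β : Fin (k * d) → EuclideanSpace ℝ (Fin d)),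
      (∀ j, famDist f (a j) = famDist f (b j)) ∧ (∀ j i, a j ≠ f i) ∧ (∀ j i, b j ≠ f i) ∧
      (∀ j, ∑ i, inner ℝ (unitVec (a j - f i)) (α j) = (1 : ℝ)) ∧
      (∀ j, ∑ i, inner ℝ (unitVec (b j - f i)) (β j) = (1 : ℝ)) ∧
      ∀ τ : Fin (k * d) → ℝ, ∃ u : Fin k → EuclideanSpace ℝ (Fin d), ∀ j,
        ∑ i, inner ℝ (unitVec (b j - f i) - unitVec (a j - f i)) (u i) = τ j := by
  have : Nontrivial (EuclideanSpace ℝ (Fin d)) := by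
    have : Nonempty (Fin d) := ⟨⟨0, by omega⟩⟩
    infer_instance
  have : Infinite (EuclideanSpace ℝ (Fin d)) := Module.Free.infinite ℝ _
  let f : Fin k → EuclideanSpace ℝ (Fin d) := fun i => Infinite.natEmbedding _ i
  have hf : Function.Injective f := fun i j h => Fin.ext ((Infinite.natEmbedding _).injective h)
  let φ : EuclideanSpace ℝ (Fin d) → EuclideanSpace ℝ (Fin d) →
      Module.Dual ℝ (Fin k → EuclideanSpace ℝ (Fin d)) := fun a b =>
    ∑ i, (innerₗ (EuclideanSpace ℝ (Fin d)) (unitVec (b - f i) - unitVec (a - f i))).comp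
      (LinearMap.proj i)
  have hφ : ∀ a b u, φ a b u = ∑ i, inner ℝ (unitVec (b - f i) - unitVec (a - f i)) (u i) := by
    intro a b u
    simp [φ, LinearMap.sum_apply, inner_sub_left, Finset.sum_sub_distrib]
  have hfr : Module.finrank ℝ (Fin k → EuclideanSpace ℝ (Fin d)) = k * d := by
    simp [Module.finrank_pi_fintype]
  obtain ⟨ψ, hψ, hsurj⟩ := exists_surjective_of_forall_exists_ne_zero
    {ψ | ∃ a b α β, ψ = φ a b ∧ famDist f a = famDist f b ∧ (∀ i, a ≠ f i) ∧ (∀ i, b ≠ f i) ∧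
      ∑ i, inner ℝ (unitVec (a - f i)) α = (1 : ℝ) ∧ ∑ i, inner ℝ (unitVec (b - f i)) β = (1 : ℝ)}
    (fun w hw => by
      obtain ⟨a, b, h1, h2, h3, ⟨α, h4⟩, ⟨β, h5⟩, h6⟩ := exists_pair_separating hd hf hw
      exact ⟨φ a b, ⟨a, b, α, β, rfl, h1, h2, h3, h4, h5⟩, by rwa [hφ]⟩)
    (k * d) hfr
  simp only [Set.mem_ofPred_eq] at hψ
  choose a b α β hab h1 h2 h3 hα hβ using hψ
  refine ⟨f, a, b, α, β, h1, h2, h3, hα, hβ, fun τ => ?_⟩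
  obtain ⟨u, hu⟩ := hsurj τ
  exact ⟨u, fun j => by rw [← hφ, ← hab, hu]⟩

theorem hasDerivAt_famDist {d k : ℕ} {f : Fin k → EuclideanSpace ℝ (Fin d)}
    {x : EuclideanSpace ℝ (Fin d)} (hx : ∀ i, x ≠ f i) (u : Fin k → EuclideanSpace ℝ (Fin d))
    (y : EuclideanSpace ℝ (Fin d)) :
    HasDerivAt (fun S : ℝ => famDist (fun i => f i + S • u i) (x + S • y))
      (∑ i, inner ℝ (unitVec (x - f i)) (y - u i)) 0 := by
  unfold famDist
  refine HasDerivAt.fun_sum fun i _ => ?_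
  have hne : ‖x - f i‖ ≠ 0 := norm_ne_zero_iff.2 (sub_ne_zero.2 (hx i))
  have h1 : HasDerivAt (fun S : ℝ => (x + S • y) - (f i + S • u i)) (y - u i) 0 := by
    have h := (((hasDerivAt_id (0 : ℝ)).smul_const y).const_add x).sub
      (((hasDerivAt_id (0 : ℝ)).smul_const (u i)).const_add (f i))
    rw [one_smul, one_smul] at h
    exact h
  have h2 := h1.norm_sq.sqrt (by simpa using hne)
  simp only [Real.sqrt_sq (norm_nonneg _), zero_smul, add_zero] at h2
  simp only [dist_eq_norm]
  have h3 : inner ℝ (unitVec (x - f i)) (y - u i) =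
      2 * inner ℝ (x - f i) (y - u i) / (2 * ‖x - f i‖) := by
    rw [unitVec, real_inner_smul_left]
    field_simp
  rw [h3]
  exact h2

open Filter Topology in
theorem eventually_lt_of_hasDerivAt {g h : ℝ → ℝ} {g' h' x : ℝ} (hg : HasDerivAt g g' x)
    (hh : HasDerivAt h h' x) (h0 : g x = h x) (hlt : g' < h') : ∀ᶠ S in 𝓝[>] x, g S < h S := by
  have h1 := (hasDerivAt_iff_tendsto_slope.1 (hh.sub hg)).eventually_const_lt (sub_pos.2 hlt)
  filter_upwards [h1.filter_mono (nhdsGT_le_nhdsNE x), self_mem_nhdsWithin] with S hS hxS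
  have hxS : x < S := hxS
  have := pos_of_slope_pos hxS hS
  simp [h0] at this
  linarith

/-- Pairs of rows of points whose comparisons can be made to follow any prescribed pattern. -/
theorem exists_rows {d k : ℕ} (hd : 2 ≤ d) (N : ℕ) :
    ∃ A B : Fin (k * d) → Fin N → EuclideanSpace ℝ (Fin d),
      ∀ s : Fin (k * d) → Fin N × Fin N, ∃ v : Fin k → EuclideanSpace ℝ (Fin d), ∀ j (i l : Fin N),
        ((N : ℤ) * (s j).2 - (s j).1 ≤ (N : ℤ) * l - i → famDist v (A j i) < famDist v (B j l)) ∧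
        ((N : ℤ) * l - i < (N : ℤ) * (s j).2 - (s j).1 →
          famDist v (B j l) < famDist v (A j i)) := by
  obtain ⟨f, a, b, α, β, hab, ha, hb, hα, hβ, hu⟩ := exists_clusters (k := k) hd
  choose! u hu using hu
  let τ : (Fin (k * d) → Fin N × Fin N) → Fin (k * d) → ℝ := fun s j =>
    (N : ℝ) * (s j).2 - (s j).1 - 1 / 2
  have hA : ∀ s j (i : Fin N), HasDerivAt (fun S : ℝ => famDist (fun m => f m + S • u (τ s) m)
      (a j + S • ((i : ℝ) • α j)))
      ((i : ℝ) - ∑ m, inner ℝ (unitVec (a j - f m)) (u (τ s) m)) 0 := by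
    intro s j i
    convert hasDerivAt_famDist (ha j) (u (τ s)) ((i : ℝ) • α j) using 1
    simp only [inner_sub_right, Finset.sum_sub_distrib, real_inner_smul_right, ← Finset.mul_sum, hα,
      mul_one]
  have hB : ∀ s j (l : Fin N), HasDerivAt (fun S : ℝ => famDist (fun m => f m + S • u (τ s) m)
      (b j + S • (((N : ℝ) * l) • β j)))
      ((N : ℝ) * l - ∑ m, inner ℝ (unitVec (b j - f m)) (u (τ s) m)) 0 := by
    intro s j l
    convert hasDerivAt_famDist (hb j) (u (τ s)) (((N : ℝ) * l) • β j) using 1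
    simp only [inner_sub_right, Finset.sum_sub_distrib, real_inner_smul_right, ← Finset.mul_sum, hβ,
      mul_one]
  have hτ : ∀ s j, (∑ m, inner ℝ (unitVec (b j - f m)) (u (τ s) m)) -
      ∑ m, inner ℝ (unitVec (a j - f m)) (u (τ s) m) = (N : ℝ) * (s j).2 - (s j).1 - 1 / 2 := by
    intro s j
    rw [← Finset.sum_sub_distrib]
    simpa only [inner_sub_left] using hu (τ s) j
  have hev : ∀ᶠ S : ℝ in nhdsWithin 0 (Set.Ioi 0), ∀ (s : Fin (k * d) → Fin N × Fin N) j
      (i l : Fin N),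
      ((N : ℤ) * (s j).2 - (s j).1 ≤ (N : ℤ) * l - i →
        famDist (fun m => f m + S • u (τ s) m) (a j + S • ((i : ℝ) • α j)) <
          famDist (fun m => f m + S • u (τ s) m) (b j + S • (((N : ℝ) * l) • β j))) ∧
      ((N : ℤ) * l - i < (N : ℤ) * (s j).2 - (s j).1 →
        famDist (fun m => f m + S • u (τ s) m) (b j + S • (((N : ℝ) * l) • β j)) <
          famDist (fun m => f m + S • u (τ s) m) (a j + S • ((i : ℝ) • α j))) := by
    simp only [Filter.eventually_all, Filter.eventually_and]
    intro s j i l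
    have h := hτ s j
    constructor <;> intro hle
    · refine eventually_lt_of_hasDerivAt (hA s j i) (hB s j l) (by simp [hab]) ?_
      have : (N : ℝ) * (s j).2 - (s j).1 ≤ (N : ℝ) * l - i := by exact_mod_cast hle
      linarith
    · refine eventually_lt_of_hasDerivAt (hB s j l) (hA s j i) (by simp [hab]) ?_
      have : (N : ℝ) * l - i + 1 ≤ (N : ℝ) * (s j).2 - (s j).1 := by
        exact_mod_cast Int.add_one_le_of_lt hle
      linarith
  obtain ⟨S, hS⟩ := hev.exists
  exact ⟨_, _, fun s => ⟨_, hS s⟩⟩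

theorem exists_strictMono_enumeration {α : Type*} (C : Finset α) {g : α → ℝ}
    (hg : Set.InjOn g C) :
    ∃ σ : Fin C.card → α, (∀ i, σ i ∈ C) ∧ StrictMono fun i => g (σ i) := by
  classical
  have hcard : (C.image g).card = C.card := Finset.card_image_of_injOn hg
  have h : ∀ i, ∃ x ∈ C, g x = (C.image g).orderEmbOfFin hcard i := fun i =>
    Finset.mem_image.1 (Finset.orderEmbOfFin_mem _ _ _)
  choose σ hσ hgσ using h
  refine ⟨σ, hσ, fun i j hij => ?_⟩
  simpa [hgσ] using hij

open MvPolynomial in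
theorem exists_le_psiCount {d k : ℕ} (hd : 2 ≤ d) (hk : 1 ≤ k) {N n : ℕ}
    (hn : 2 * N * (k * d) ≤ n) :
    ∃ C : Finset (EuclideanSpace ℝ (Fin d)), C.card = n ∧ (N ^ 2) ^ (k * d) ≤ psiCount k C := by
  classical
  have : Nontrivial (EuclideanSpace ℝ (Fin d)) := by
    have : Nonempty (Fin d) := ⟨⟨0, by omega⟩⟩
    infer_instance
  have : Infinite (EuclideanSpace ℝ (Fin d)) := Module.Free.infinite ℝ _
  obtain ⟨A, B, hAB⟩ := exists_rows (k := k) hd N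
  have hcard : (Finset.univ.image (fun p : Fin (k * d) × Fin N => A p.1 p.2) ∪
      Finset.univ.image fun p : Fin (k * d) × Fin N => B p.1 p.2).card ≤ n := by
    refine (Finset.card_union_le _ _).trans ?_
    have h1 := Finset.card_image_le (s := Finset.univ)
      (f := fun p : Fin (k * d) × Fin N => A p.1 p.2)
    have h2 := Finset.card_image_le (s := Finset.univ)
      (f := fun p : Fin (k * d) × Fin N => B p.1 p.2)
    simp only [Finset.card_univ, Fintype.card_prod, Fintype.card_fin] at h1 h2
    nlinarith
  obtain ⟨C, hC, rfl⟩ := Infinite.exists_superset_card_eq _ _ hcard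
  have hAC : ∀ j i, A j i ∈ C := fun j i =>
    hC (Finset.mem_union_left _ (Finset.mem_image.2 ⟨(j, i), Finset.mem_univ _, rfl⟩))
  have hBC : ∀ j i, B j i ∈ C := fun j i =>
    hC (Finset.mem_union_right _ (Finset.mem_image.2 ⟨(j, i), Finset.mem_univ _, rfl⟩))
  refine ⟨C, rfl, ?_⟩
  obtain ⟨e, he⟩ := exists_polynomial_injOn hd hk
  obtain ⟨P, hP0, -, hP⟩ := he C
  have hperturb : ∀ s : Fin (k * d) → Fin N × Fin N, ∃ v : Fin k → EuclideanSpace ℝ (Fin d),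
      Set.InjOn (famDist v) C ∧ ∀ j (i l : Fin N),
        ((N : ℤ) * (s j).2 - (s j).1 ≤ (N : ℤ) * l - i → famDist v (A j i) < famDist v (B j l)) ∧
        ((N : ℤ) * l - i < (N : ℤ) * (s j).2 - (s j).1 →
          famDist v (B j l) < famDist v (A j i)) := by
    intro s
    obtain ⟨v, hv⟩ := hAB s
    let w : Fin k × Fin d → ℝ := fun p => v p.1 p.2
    have hw : pointsOfCoords w = v := rfl
    have hlt : ∀ x y, famDist v x < famDist v y →
        ∀ᶠ z in nhds w, famDist (pointsOfCoords z) x < famDist (pointsOfCoords z) y :=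
      fun x y hxy => (continuous_famDist_pointsOfCoords x).continuousAt.eventually_lt
        (continuous_famDist_pointsOfCoords y).continuousAt hxy
    have hev : ∀ᶠ z in nhds w, ∀ j (i l : Fin N),
        ((N : ℤ) * (s j).2 - (s j).1 ≤ (N : ℤ) * l - i →
          famDist (pointsOfCoords z) (A j i) < famDist (pointsOfCoords z) (B j l)) ∧
        ((N : ℤ) * l - i < (N : ℤ) * (s j).2 - (s j).1 →
          famDist (pointsOfCoords z) (B j l) < famDist (pointsOfCoords z) (A j i)) := by
      simp only [Filter.eventually_all, Filter.eventually_and]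
      exact fun j i l => ⟨fun h => hlt _ _ ((hv j i l).1 h), fun h => hlt _ _ ((hv j i l).2 h)⟩
    by_contra! hcon
    refine hP0 (eq_zero_of_eventually_eval_eq_zero (x := w) ?_)
    filter_upwards [hev] with z hz
    by_contra hPz
    obtain ⟨j, i, l, h⟩ := hcon _ (hP z hPz)
    exact absurd (h (hz j i l).1).2 (not_le.2 ((hz j i l).2 (h (hz j i l).1).1))
  choose v hinj hv using hperturb
  choose σ hσC hσ using fun s => exists_strictMono_enumeration C (hinj s)
  have hmem : ∀ s, σ s ∈ PsiSet k C.card C := fun s => by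
    obtain ⟨V, hVk, hV⟩ := exists_multiset_sumDist_eq (v s)
    exact ⟨fun i j hij => (hσ s).injective (congrArg (famDist (v s)) hij), hσC s, V, hVk,
      by rw [hV]; exact hinj s, by rw [hV]; exact hσ s⟩
  have hcomp : ∀ s s', σ s = σ s' → ∀ x ∈ C, ∀ y ∈ C, famDist (v s) x < famDist (v s) y →
      famDist (v s') x < famDist (v s') y := by
    intro s s' hss x hx y hy hxy
    have hrange := range_eq_of_mem_psiSet (hmem s)
    obtain ⟨p, rfl⟩ : x ∈ Set.range (σ s) := hrange ▸ hx
    obtain ⟨q, rfl⟩ : y ∈ Set.range (σ s) := hrange ▸ hy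
    rw [hss]
    exact hσ s' ((hσ s).lt_iff_lt.1 hxy)
  have hle : ∀ s s', σ s = σ s' → ∀ j,
      (N : ℤ) * (s' j).2 - (s' j).1 ≤ (N : ℤ) * (s j).2 - (s j).1 := by
    intro s s' hss j
    by_contra! hlt
    have h1 := hcomp s s' hss _ (hAC j _) _ (hBC j _) ((hv s j (s j).1 (s j).2).1 le_rfl)
    exact lt_asymm h1 ((hv s' j (s j).1 (s j).2).2 hlt)
  have := (finite_psiSet k C.card C).to_subtype
  have hinjσ : Function.Injective
      fun s => (⟨σ s, hmem s⟩ : PsiSet k C.card C) := by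
    intro s s' hss
    have hss : σ s = σ s' := congrArg Subtype.val hss
    funext j
    have h1 := le_antisymm (hle s' s hss.symm j) (hle s s' hss j)
    have h2 : (s j).2.1 * N + (s' j).1.1 = (s' j).2.1 * N + (s j).1.1 := by
      zify
      linarith
    have h3 : (s j).2.1 = (s' j).2.1 := by
      have h4 := congrArg (· / N) h2
      have hN : 0 < N := (s j).1.pos
      simpa [Nat.mul_add_div, mul_comm _ N, hN, Nat.div_eq_of_lt] using h4
    refine Prod.ext (Fin.ext ?_) (Fin.ext h3)
    rw [h3] at h2
    omega
  have := Nat.card_le_card_of_injective _ hinjσ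
  simpa [psiCount, sq] using this

/-- For fixed `d ≥ 2` and `k ≥ 1`, `ψ^max_{d,k}(n) = Θ_{d,k}(n^{2dk})`. -/
theorem psiMax_isTheta (d k : ℕ) (hd : 2 ≤ d) (hk : 1 ≤ k) :
    ∃ c₁ c₂ : ℝ, 0 < c₁ ∧ 0 < c₂ ∧ ∃ N : ℕ, ∀ n : ℕ, N ≤ n →
      c₁ * (n : ℝ) ^ (2 * d * k) ≤ (psiMax d k n : ℝ) ∧
      (psiMax d k n : ℝ) ≤ c₂ * (n : ℝ) ^ (2 * d * k) := by
  obtain ⟨e, he⟩ := psiCount_le (d := d) hd hk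
  have hD : 1 ≤ k * d := Nat.mul_pos hk (by omega)
  have hexp : 2 * d * k = 2 * (k * d) := by ring
  set D := k * d with hDdef
  rw [hexp]
  have hD0 : (0 : ℝ) < D := by exact_mod_cast hD
  refine ⟨(1 / (4 * D)) ^ (2 * D), ((2 * e + 2) * D + 1) ^ D, by positivity, by positivity, 2 * D,
    fun n hn => ?_⟩
  have hub : ∀ m ∈ {m | ∃ C : Finset (EuclideanSpace ℝ (Fin d)), C.card = n ∧ psiCount k C = m},
      m ≤ ((2 * (n ^ 2 * e) + 2) * D + 1) ^ D := by
    rintro m ⟨C, rfl, rfl⟩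
    exact he C
  have hq := Nat.div_add_mod n (2 * D)
  have hr := Nat.mod_lt n (show 2 * D > 0 by omega)
  have hq1 : 1 ≤ n / (2 * D) := (Nat.one_le_div_iff (by omega)).2 hn
  set q := n / (2 * D)
  obtain ⟨C, hCn, hC⟩ := exists_le_psiCount hd hk (N := q) (n := n)
    (by rw [← hDdef, mul_right_comm]; exact Nat.mul_div_le n (2 * D))
  constructor
  · have h1 : (q ^ 2) ^ D ≤ psiMax d k n := hC.trans (le_csSup ⟨_, hub⟩ ⟨C, hCn, rfl⟩)
    have h2 : n ≤ 4 * D * q := by nlinarith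
    calc (1 / (4 * D) : ℝ) ^ (2 * D) * (n : ℝ) ^ (2 * D) = (n / (4 * D)) ^ (2 * D) := by
          rw [← mul_pow]; congr 1; ring
      _ ≤ (q : ℝ) ^ (2 * D) := by
          refine pow_le_pow_left₀ (by positivity) ?_ _
          rw [div_le_iff₀ (by positivity), mul_comm]
          exact_mod_cast h2
      _ ≤ psiMax d k n := by
          rw [pow_mul]
          exact_mod_cast h1
  · have h1 : psiMax d k n ≤ ((2 * (n ^ 2 * e) + 2) * D + 1) ^ D := csSup_le ⟨_, C, hCn, rfl⟩ hub
    have hn1 : 1 ≤ n ^ 2 := Nat.one_le_pow _ _ (by omega)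
    have h2 : (2 * (n ^ 2 * e) + 2) * D + 1 ≤ ((2 * e + 2) * D + 1) * n ^ 2 := by nlinarith
    have h3 := h1.trans (Nat.pow_le_pow_left h2 D)
    rw [mul_pow, ← pow_mul] at h3
    exact_mod_cast h3
end

section
/- Let N, m, Δ, r, s be positive integers with r ≥ 2, and let F = (f_1,…,f_m), where each f_i : ℝ^N → ℝ has the form f_i = Σ_{j=1}^{r_i} a_{i,j} g_{i,j}^{1/s} with r_i ≤ r a positive integer, each a_{i,j} a real number, and each g_{i,j} ∈ ℝ[x_1,…,x_N] a polynomial of degree at most Δ satisfying g_{i,j}(x) ≥ 0 for all x ∈ ℝ^N. Then the number of distinct proper sign patterns of the form ε_F(x) for x ∈ ℝ^N is at most 2(2 s^{r−2} Δ)^N Σ_{ℓ=0}^N 2^ℓ C(m, ℓ). -/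
namespace RadicalNorm

open MvPolynomial Filter Topology

lemma coeff_aeval_C_mul_X {σ R : Type*} [CommSemiring R] (c : σ → R) (p : MvPolynomial σ R)
    (α : σ →₀ ℕ) :
    coeff α (aeval (fun i => C (c i) * X i) p) = (α.prod fun i k => c i ^ k) * coeff α p := by
  classical
  induction p using MvPolynomial.induction_on' with
  | monomial β b =>
    have : aeval (fun i => C (c i) * X i) (monomial β b)
        = monomial β (b * β.prod fun i k => c i ^ k) := by
      rw [aeval_monomial, monomial_eq, algebraMap_eq, C_mul, mul_assoc]
      congr 1
      simp only [Finsupp.prod, mul_pow, Finset.prod_mul_distrib, map_prod, map_pow]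
    rw [this, coeff_monomial, coeff_monomial]
    split_ifs with h
    · subst h; ring
    · simp
  | add p q hp hq => rw [map_add, coeff_add, coeff_add, hp, hq, mul_add]

section RootsOfUnity

variable {q s : ℕ} [NeZero s]

attribute [local instance] Fintype.ofFinite

/-- The product of all the conjugates of `X 0 + X 1 + ⋯ + X (q + 1)` under multiplication of the
variables by `s`-th roots of unity, normalised so that `X 0` is fixed. -/
noncomputable def conjProd (q s : ℕ) [NeZero s] : MvPolynomial (Fin (q + 2)) ℂ :=
  ∏ ζ : Fin (q + 1) → rootsOfUnity s ℂ,
    (X 0 + ∑ j, C ((ζ j : ℂˣ) : ℂ) * X j.succ)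

lemma card_conj : Fintype.card (Fin (q + 1) → rootsOfUnity s ℂ) = s ^ (q + 1) := by
  rw [Fintype.card_fun, ← Nat.card_eq_fintype_card, Complex.card_rootsOfUnity, Fintype.card_fin]

lemma totalDegree_conjProd_le : (conjProd q s).totalDegree ≤ s ^ (q + 1) := by
  refine (totalDegree_finsetProd _ _).trans ?_
  rw [← card_conj (q := q) (s := s)]
  refine (Finset.sum_le_card_nsmul _ _ 1 fun ζ _ => ?_).trans (by simp)
  refine (totalDegree_add _ _).trans (max_le (by simp) (totalDegree_finsetSum_le fun j _ => ?_))
  exact (totalDegree_mul _ _).trans (by simp)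

omit [NeZero s] in
lemma root_pow (ζ : rootsOfUnity s ℂ) : ((ζ : ℂˣ) : ℂ) ^ s = 1 := by
  simpa using congrArg Units.val ((mem_rootsOfUnity s (ζ : ℂˣ)).1 ζ.2)

lemma aeval_conjProd (η : Fin (q + 2) → rootsOfUnity s ℂ) :
    aeval (fun i => C ((η i : ℂˣ) : ℂ) * X i) (conjProd q s) = conjProd q s := by
  have hfac : ∀ ζ : Fin (q + 1) → rootsOfUnity s ℂ,
      aeval (fun i => C ((η i : ℂˣ) : ℂ) * X i)
        (X 0 + ∑ j, C ((ζ j : ℂˣ) : ℂ) * X j.succ : MvPolynomial (Fin (q + 2)) ℂ)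
      = C ((η 0 : ℂˣ) : ℂ) * (X 0 + ∑ j, C (((ζ j * (η j.succ / η 0) : rootsOfUnity s ℂ) : ℂˣ) : ℂ)
          * X j.succ) := by
    intro ζ
    have h0 : ((η 0 : ℂˣ) : ℂ) ≠ 0 := Units.ne_zero _
    rw [mul_add, Finset.mul_sum, map_add, map_sum, aeval_X]
    refine congrArg₂ _ rfl (Finset.sum_congr rfl fun j _ => ?_)
    have hc : ((ζ j : ℂˣ) : ℂ) * ((η j.succ : ℂˣ) : ℂ) = ((η 0 : ℂˣ) : ℂ) *
        (((ζ j * (η j.succ / η 0) : rootsOfUnity s ℂ) : ℂˣ) : ℂ) := by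
      push_cast [div_eq_mul_inv]
      field_simp
    rw [map_mul, aeval_C, aeval_X, algebraMap_eq, ← mul_assoc, ← C_mul, hc, C_mul, mul_assoc]
  rw [conjProd, map_prod, Finset.prod_congr rfl fun ζ _ => hfac ζ, Finset.prod_mul_distrib,
    Finset.prod_const, Finset.card_univ, card_conj, ← C_pow, pow_succ', pow_mul, root_pow, one_pow,
    C_1, one_mul]
  exact Fintype.prod_equiv (Equiv.mulRight fun j => η j.succ / η 0) _ _ fun ζ => by simp

lemma dvd_of_mem_support_conjProd {α : Fin (q + 2) →₀ ℕ} (hα : α ∈ (conjProd q s).support)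
    (i : Fin (q + 2)) : s ∣ α i := by
  classical
  have hprim := Complex.isPrimitiveRoot_exp s (NeZero.ne s)
  let ω : rootsOfUnity s ℂ := hprim.toRootsOfUnity
  have hω : ((ω : ℂˣ) : ℂ) = Complex.exp (2 * Real.pi * Complex.I / s) := rfl
  have h := congrArg (coeff α) (aeval_conjProd (q := q) (Pi.mulSingle i ω))
  rw [coeff_aeval_C_mul_X] at h
  rw [mem_support_iff] at hα
  have h1 := mul_right_cancel₀ hα (h.trans (one_mul _).symm)
  rw [Finsupp.prod_fintype _ _ (by simp), Finset.prod_eq_single i] at h1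
  · rw [Pi.mulSingle_eq_same, hω] at h1
    exact (hprim.pow_eq_one_iff_dvd _).1 h1
  · intro j _ hj
    simp [Pi.mulSingle_eq_of_ne hj]
  · simp

lemma eval_conjProd (y : Fin (q + 2) → ℂ) : eval y (conjProd q s) =
    ∏ ζ : Fin (q + 1) → rootsOfUnity s ℂ, (y 0 + ∑ j, ((ζ j : ℂˣ) : ℂ) * y j.succ) := by
  simp [conjProd]

lemma conj_eval_conjProd (y : Fin (q + 2) → ℝ) :
    (starRingEnd ℂ) (eval (fun i => (y i : ℂ)) (conjProd q s))
      = eval (fun i => (y i : ℂ)) (conjProd q s) := by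
  rw [eval_conjProd, map_prod]
  refine Fintype.prod_equiv (Equiv.inv _) _ _ fun ζ => ?_
  simp only [map_add, map_sum, map_mul, Complex.conj_ofReal, Equiv.inv_apply, Pi.inv_apply]
  congr 1
  refine Finset.sum_congr rfl fun j _ => ?_
  rw [Complex.conj_rootsOfUnity (ζ j).2]
  simp

/-- A sum of `q + 2` radicals is a factor of a polynomial of degree at most `s ^ q * Δ`. -/
theorem exists_polynomial_eval_eq_zero_iff {σ : Type*} {Δ : ℕ} (a : Fin (q + 2) → ℝ)
    (g : Fin (q + 2) → MvPolynomial σ ℝ) (hdeg : ∀ j, (g j).totalDegree ≤ Δ)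
    (hpos : ∀ j x, 0 ≤ eval x (g j)) :
    ∃ P : MvPolynomial σ ℝ, P.totalDegree ≤ s ^ q * Δ ∧ ∀ x, eval x P = 0 ↔
      ∃ ζ : Fin (q + 1) → rootsOfUnity s ℂ,
        ((a 0 * eval x (g 0) ^ ((s : ℝ)⁻¹) : ℝ) : ℂ) +
        ∑ j : Fin (q + 1), ((ζ j : ℂˣ) : ℂ) * ((a j.succ * eval x (g j.succ) ^ ((s : ℝ)⁻¹) : ℝ) : ℂ)
          = 0 := by
  refine ⟨∑ α ∈ (conjProd q s).support, C (coeff α (conjProd q s)).re *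
    ∏ i, (C (a i ^ s) * g i) ^ (α i / s), ?_, fun x => ?_⟩
  · refine totalDegree_finsetSum_le fun α hα => (totalDegree_mul _ _).trans ?_
    rw [totalDegree_C, zero_add]
    refine (totalDegree_finsetProd _ _).trans ?_
    have h1 : ∀ i, ((C (a i ^ s) * g i) ^ (α i / s)).totalDegree ≤ α i / s * Δ := fun i => by
      refine (totalDegree_pow _ _).trans (Nat.mul_le_mul_left _ ((totalDegree_mul _ _).trans ?_))
      rw [totalDegree_C, zero_add]
      exact hdeg i
    refine (Finset.sum_le_sum fun i _ => h1 i).trans ?_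
    rw [← Finset.sum_mul]
    refine Nat.mul_le_mul_right _ ?_
    have h2 : ∑ i, α i ≤ s ^ (q + 1) := by
      refine le_trans ?_ ((le_totalDegree hα).trans totalDegree_conjProd_le)
      rw [Finsupp.sum_fintype _ _ (by simp)]
    refine Nat.le_of_mul_le_mul_left ?_ (NeZero.pos s)
    rw [Finset.mul_sum, Finset.sum_congr rfl fun i _ =>
      Nat.mul_div_cancel' (dvd_of_mem_support_conjProd hα i), ← pow_succ']
    exact h2
  · set y : Fin (q + 2) → ℝ := fun i => a i * eval x (g i) ^ ((s : ℝ)⁻¹) with hy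
    have hys : ∀ i, y i ^ s = a i ^ s * eval x (g i) := fun i => by
      rw [hy]; simp only [mul_pow]
      rw [Real.rpow_inv_natCast_pow (hpos i x) (NeZero.ne s)]
    have key : eval x (∑ α ∈ (conjProd q s).support, C (coeff α (conjProd q s)).re *
        ∏ i, (C (a i ^ s) * g i) ^ (α i / s))
        = (eval (fun i => (y i : ℂ)) (conjProd q s)).re := by
      rw [map_sum, eval_eq, Complex.re_sum]
      refine Finset.sum_congr rfl fun α hα => ?_
      have : ∏ i ∈ α.support, (y i : ℂ) ^ α i = ((∏ i, y i ^ α i : ℝ) : ℂ) := by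
        push_cast
        exact Finset.prod_subset (Finset.subset_univ _) fun i _ hi => by
          simp [Finsupp.notMem_support_iff.1 hi]
      rw [this, Complex.re_mul_ofReal]
      simp only [map_mul, eval_C, eval_prod, map_pow]
      congr 1
      refine Finset.prod_congr rfl fun i _ => ?_
      rw [← hys, ← pow_mul, Nat.mul_div_cancel' (dvd_of_mem_support_conjProd hα i)]
    rw [key]
    have hre := Complex.conj_eq_iff_re.1 (conj_eval_conjProd (s := s) y)
    have : (eval (fun i => (y i : ℂ)) (conjProd q s)).re = 0 ↔
        eval (fun i => (y i : ℂ)) (conjProd q s) = 0 := by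
      rw [← hre]; simp
    rw [this, eval_conjProd, Finset.prod_eq_zero_iff]
    simp only [Finset.mem_univ, true_and, hy]

end RootsOfUnity

lemma eventually_polynomial_eval_ne_zero {p : Polynomial ℂ} (hp : p ≠ 0) :
    ∀ᶠ t : ℝ in 𝓝[≠] 0, p.eval (t : ℂ) ≠ 0 := by
  have hfin : {t : ℝ | p.eval (t : ℂ) = 0}.Finite :=
    (p.rootSet_finite ℂ |>.preimage Complex.ofReal_injective.injOn).subset fun t ht => by
      simpa [Polynomial.mem_rootSet, hp] using ht
  have := (hfin.subset (Set.sdiff_subset (t := {0}))).isClosed.compl_mem_nhds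
    (x := 0) (by simp)
  rw [eventually_nhdsWithin_iff]
  filter_upwards [this] with t ht ht0 h
  exact ht ⟨h, ht0⟩

lemma eventually_sum_ne_zero {n : ℕ} (a γ : Fin n → ℝ) (ξ : Fin n → ℂ) (hξ : ∀ j, ξ j ≠ 0)
    (hγ : ∃ j, γ j ≠ 0) :
    ∀ᶠ t : ℝ in 𝓝[≠] 0, ∑ j, ξ j * (((a j + t ^ ((j : ℕ) + 1)) * γ j : ℝ) : ℂ) ≠ 0 := by
  obtain ⟨k, hk⟩ := hγ
  let p : Polynomial ℂ :=
    ∑ j, Polynomial.C (ξ j * γ j) * (Polynomial.C (a j : ℂ) + Polynomial.X ^ ((j : ℕ) + 1))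
  have hp : p ≠ 0 := fun h => by
    have h1 := congrArg (Polynomial.coeff · ((k : ℕ) + 1)) h
    simp only [p, Polynomial.finsetSum_coeff, Polynomial.coeff_C_mul, Polynomial.coeff_add,
      Polynomial.coeff_C_succ, Polynomial.coeff_X_pow, zero_add, Polynomial.coeff_zero] at h1
    rw [Finset.sum_eq_single k] at h1
    · simp [hξ k, hk] at h1
    · intro j _ hj
      rw [if_neg, mul_zero]
      exact fun h => hj (Fin.ext (by omega))
    · simp
  filter_upwards [eventually_polynomial_eval_ne_zero hp] with t ht h
  refine ht (Eq.trans ?_ h)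
  simp only [p, Polynomial.eval_finsetSum, Polynomial.eval_mul, Polynomial.eval_add,
    Polynomial.eval_C, Polynomial.eval_pow, Polynomial.eval_X]
  refine Finset.sum_congr rfl fun j _ => ?_
  push_cast
  ring

/-- After a small change of its coefficients, a sum of radicals keeps its signs at finitely many
prescribed points and its zeros lie on a hypersurface of small degree avoiding these points. -/
theorem exists_perturbation {σ : Type*} {q s Δ : ℕ} [NeZero s] (a : Fin (q + 2) → ℝ)
    (g : Fin (q + 2) → MvPolynomial σ ℝ) (hdeg : ∀ j, (g j).totalDegree ≤ Δ)
    (hpos : ∀ j x, 0 ≤ eval x (g j)) (Y : Set (σ → ℝ)) (hY : Y.Finite)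
    (hne : ∀ x ∈ Y, ∑ j, a j * eval x (g j) ^ ((s : ℝ)⁻¹) ≠ 0) :
    ∃ (F : (σ → ℝ) → ℝ) (P : MvPolynomial σ ℝ), Continuous F ∧ P.totalDegree ≤ s ^ q * Δ ∧
      (∀ x, F x = 0 → eval x P = 0) ∧ ∀ x ∈ Y, eval x P ≠ 0 ∧
        SignType.sign (F x) = SignType.sign (∑ j, a j * eval x (g j) ^ ((s : ℝ)⁻¹)) := by
  classical
  set γ : (σ → ℝ) → Fin (q + 2) → ℝ := fun x j => eval x (g j) ^ ((s : ℝ)⁻¹) with hγ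
  have hsign : ∀ x ∈ Y, ∀ᶠ t : ℝ in 𝓝[≠] 0,
      SignType.sign (∑ j, (a j + t ^ ((j : ℕ) + 1)) * γ x j)
        = SignType.sign (∑ j, a j * γ x j) := fun x hx => by
    have hc : Continuous fun t : ℝ => ∑ j, (a j + t ^ ((j : ℕ) + 1)) * γ x j := by fun_prop
    have h0 : (∑ j, (a j + (0 : ℝ) ^ ((j : ℕ) + 1)) * γ x j) = ∑ j, a j * γ x j := by simp
    have ht := hc.tendsto 0
    rw [h0] at ht
    have := (continuousAt_sign_of_ne_zero (hne x hx)).tendsto.comp ht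
    rw [nhds_discrete SignType, tendsto_pure] at this
    exact this.filter_mono nhdsWithin_le_nhds
  have hfac : ∀ x ∈ Y, ∀ ζ : Fin (q + 1) → rootsOfUnity s ℂ, ∀ᶠ t : ℝ in 𝓝[≠] 0,
      (((a 0 + t ^ (((0 : Fin (q + 2)) : ℕ) + 1)) * γ x 0 : ℝ) : ℂ) + ∑ j : Fin (q + 1),
        ((ζ j : ℂˣ) : ℂ) * (((a j.succ + t ^ ((j.succ : ℕ) + 1)) * γ x j.succ : ℝ) : ℂ) ≠ 0 := by
    intro x hx ζ
    have := eventually_sum_ne_zero a (γ x) (Fin.cons 1 fun j => ((ζ j : ℂˣ) : ℂ))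
      (fun j => by refine Fin.cases ?_ (fun j => ?_) j <;> simp)
      (by
        by_contra! h
        exact hne x hx (Finset.sum_eq_zero fun j _ => by rw [show _ ^ _ = _ from h j, mul_zero]))
    filter_upwards [this] with t ht
    rwa [Fin.sum_univ_succ, Fin.cons_zero, one_mul] at ht
  obtain ⟨t, ht1, ht2⟩ := (((eventually_all_finite hY).2 hsign).and
    ((eventually_all_finite hY).2 fun x hx => eventually_all.2 (hfac x hx))).exists
  obtain ⟨P, hPd, hP⟩ := exists_polynomial_eval_eq_zero_iff (s := s)
    (fun j => a j + t ^ ((j : ℕ) + 1)) g hdeg hpos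
  refine ⟨fun x => ∑ j, (a j + t ^ ((j : ℕ) + 1)) * γ x j, P, ?_, hPd, fun x hx => ?_,
    fun x hx => ⟨fun h => ?_, ht1 x hx⟩⟩
  · refine continuous_finsetSum _ fun j _ => continuous_const.mul ?_
    exact (MvPolynomial.continuous_eval _).rpow_const fun x => Or.inr (by positivity)
  · refine (hP x).2 ⟨fun _ => 1, ?_⟩
    beta_reduce at hx
    rw [Fin.sum_univ_succ] at hx
    simpa [hγ] using congrArg (fun u : ℝ => (u : ℂ)) hx
  · obtain ⟨ζ, hζ⟩ := (hP x).1 h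
    exact ht2 x hx ζ hζ

end RadicalNorm

namespace FiberCount

open MvPolynomial Filter Topology

section Exponents

variable {σ : Type*} [Fintype σ] [DecidableEq σ]

/-- The exponents of the monomials of total degree at most `n`. -/
def exponents (σ : Type*) [Fintype σ] [DecidableEq σ] (n : ℕ) : Finset (σ → ℕ) :=
  {a ∈ Fintype.piFinset fun _ => Finset.range (n + 1) | ∑ i, a i ≤ n}

lemma mem_exponents {n : ℕ} {a : σ → ℕ} : a ∈ exponents σ n ↔ ∑ i, a i ≤ n := by
  simp only [exponents, Finset.mem_filter, Fintype.mem_piFinset, Finset.mem_range,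
    and_iff_right_iff_imp]
  exact fun h i => Nat.lt_succ_of_le
    ((Finset.single_le_sum (fun _ _ => Nat.zero_le _) (Finset.mem_univ i)).trans h)

lemma card_exponents_le (n : ℕ) : (exponents σ n).card ≤ (n + 1) ^ Fintype.card σ := by
  refine (Finset.card_filter_le _ _).trans ?_
  simp [Fintype.card_piFinset]

lemma card_exponents_mul_add_le {e : ℕ} (he : 0 < e) (A B : ℕ) :
    (exponents σ (e * A + B)).card ≤ e ^ Fintype.card σ * (exponents σ (A + B)).card := by
  have : e ^ Fintype.card σ * (exponents σ (A + B)).card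
      = ((Fintype.piFinset fun _ : σ => Finset.range e) ×ˢ exponents σ (A + B)).card := by
    simp [Fintype.card_piFinset]
  rw [this]
  refine Finset.card_le_card_of_injOn (fun a => (fun i => a i % e, fun i => a i / e)) ?_ ?_
  · intro a ha
    rw [Finset.mem_coe, mem_exponents] at ha
    simp only [Finset.coe_product, Set.mem_prod, Finset.mem_coe, Fintype.mem_piFinset,
      Finset.mem_range, mem_exponents]
    refine ⟨fun i => Nat.mod_lt _ he, ?_⟩
    refine Nat.le_of_mul_le_mul_left (c := e) ?_ he
    calc e * ∑ i, a i / e = ∑ i, e * (a i / e) := Finset.mul_sum _ _ _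
      _ ≤ ∑ i, a i := Finset.sum_le_sum fun i _ => Nat.mul_div_le _ _
      _ ≤ e * A + B := ha
      _ ≤ e * (A + B) := by nlinarith
  · intro a _ b _ h
    simp only [Prod.mk.injEq] at h
    funext i
    rw [← Nat.div_add_mod (a i) e, ← Nat.div_add_mod (b i) e, congrFun h.1 i, congrFun h.2 i]

lemma le_pow_of_forall_mul_card_exponents_le {e B K : ℕ} (he : 0 < e)
    (h : ∀ A, K * (exponents σ A).card ≤ (exponents σ (e * A + B)).card) :
    K ≤ e ^ Fintype.card σ := by
  by_contra! hlt
  set E := e ^ Fintype.card σ with hE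
  have hEpos : 0 < E := pow_pos he _
  have step : ∀ n, (E + 1) ^ n ≤ E ^ n * (exponents σ (n * B)).card := by
    intro n
    induction n with
    | zero =>
      have : (fun _ => 0 : σ → ℕ) ∈ exponents σ (0 * B) := mem_exponents.2 (by simp)
      simpa using Finset.card_pos.2 ⟨_, this⟩
    | succ n ih =>
      calc (E + 1) ^ (n + 1) ≤ (E ^ n * (exponents σ (n * B)).card) * (E + 1) := by
            rw [pow_succ]; exact Nat.mul_le_mul_right _ ih
        _ ≤ (E ^ n * (exponents σ (n * B)).card) * K := Nat.mul_le_mul_left _ hlt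
        _ = E ^ n * (K * (exponents σ (n * B)).card) := by ring
        _ ≤ E ^ n * (E * (exponents σ (n * B + B)).card) :=
            Nat.mul_le_mul_left _ ((h _).trans (card_exponents_mul_add_le he _ _))
        _ = E ^ (n + 1) * (exponents σ ((n + 1) * B)).card := by
            rw [add_one_mul, pow_succ]; ring
  have hE1 : (1 : ℝ) < ((E + 1 : ℕ) : ℝ) / E := by
    rw [one_lt_div (by exact_mod_cast hEpos)]
    exact_mod_cast Nat.lt_succ_self E
  have bound : ∀ n : ℕ, (((E + 1 : ℕ) : ℝ) / E) ^ n ≤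
      ((B + 1 : ℕ) : ℝ) ^ Fintype.card σ * ((n + 1 : ℕ) : ℝ) ^ Fintype.card σ := by
    intro n
    rw [div_pow, div_le_iff₀ (by positivity)]
    have h1 : (E + 1) ^ n ≤ (B + 1) ^ Fintype.card σ * (n + 1) ^ Fintype.card σ * E ^ n := by
      refine (step n).trans ?_
      rw [mul_comm, ← mul_pow]
      refine Nat.mul_le_mul_right _ ((card_exponents_le _).trans (Nat.pow_le_pow_left ?_ _))
      nlinarith
    exact_mod_cast h1
  have lim := tendsto_pow_const_div_const_pow_of_one_lt (Fintype.card σ) hE1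
  have lim2 := (lim.comp (tendsto_add_atTop_nat 1)).const_mul
    (((B + 1 : ℕ) : ℝ) ^ Fintype.card σ * (((E + 1 : ℕ) : ℝ) / E))
  rw [mul_zero] at lim2
  obtain ⟨n, hn⟩ := (lim2.eventually (gt_mem_nhds one_pos)).exists
  have hpos : (0 : ℝ) < (((E + 1 : ℕ) : ℝ) / E) ^ (n + 1) := by positivity
  simp only [Function.comp_apply] at hn
  rw [mul_div_assoc', div_lt_one hpos, pow_succ (((E + 1 : ℕ) : ℝ) / E) n] at hn
  have := mul_le_mul_of_nonneg_right (bound n) (zero_le_one.trans hE1.le)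
  nlinarith

lemma finrank_restrictTotalDegree_le (n : ℕ) :
    Module.finrank ℝ (restrictTotalDegree σ ℝ n) ≤ (exponents σ n).card := by
  rw [restrictTotalDegree, Module.finrank_eq_nat_card_basis (basisRestrictSupport ℝ _),
    ← Fintype.card_coe, ← Nat.card_eq_fintype_card]
  refine Nat.card_le_card_of_injective (fun a => ⟨a.1, mem_exponents.2 ?_⟩) fun a b h => ?_
  · rw [← Finsupp.sum_fintype a.1 (fun _ e => e) fun _ => rfl]
    exact a.2
  · exact Subtype.ext (DFunLike.coe_injective (congrArg Subtype.val h))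

end Exponents

/-- A nonzero polynomial does not vanish on a neighbourhood of a point. -/
lemma eq_zero_of_eventually_eval_eq_zero {σ : Type*} [Fintype σ] {p : MvPolynomial σ ℝ}
    {x : σ → ℝ} (h : ∀ᶠ y in 𝓝 x, eval y p = 0) : p = 0 := by
  obtain ⟨ε, hε, hball⟩ := Metric.eventually_nhds_iff_ball.1 h
  refine funext_set (fun i => Metric.ball (x i) ε) (fun i => ?_) fun y hy => ?_
  · exact infinite_of_mem_nhds (x i) (Metric.ball_mem_nhds _ hε)
  · rw [map_zero]
    exact hball y (by rwa [ball_pi _ hε])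

/-- Pairwise disjoint compact sets are separated by a polynomial. -/
lemma exists_separating_polynomial {σ : Type*} [Fintype σ] {n : ℕ} {K : Fin n → Set (σ → ℝ)}
    (hK : ∀ k, IsCompact (K k)) (hdisj : Pairwise (Function.onFun Disjoint K)) :
    ∃ h : MvPolynomial σ ℝ, ∀ k l, ∀ x ∈ K k, ∀ y ∈ K l, eval x h = eval y h → k = l := by
  have hu : ∀ k, ∃ u : C(σ → ℝ, ℝ), (∀ l ≠ k, ∀ x ∈ K l, u x = 0) ∧ ∀ x ∈ K k, u x = 1 := by
    intro k
    obtain ⟨u, h0, h1, -⟩ := exists_continuous_zero_one_of_isClosed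
      (s := ⋃ l ∈ {l | l ≠ k}, K l) (t := K k)
      ((Set.toFinite _).isClosed_biUnion fun l _ => (hK l).isClosed) (hK k).isClosed
      (Set.disjoint_iUnion₂_left.2 fun l hl => hdisj hl)
    exact ⟨u, fun l hl x hx => h0 (Set.mem_biUnion (t := K) (show l ∈ {l | l ≠ k} from hl) hx), h1⟩
  choose u hu0 hu1 using hu
  let φ : C(σ → ℝ, ℝ) := ∑ k : Fin n, ((k : ℕ) : ℝ) • u k
  have hφ : ∀ k, ∀ x ∈ K k, φ x = ((k : ℕ) : ℝ) := by
    intro k x hx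
    simp only [φ, ContinuousMap.coe_sum, ContinuousMap.coe_smul, Finset.sum_apply, Pi.smul_apply,
      smul_eq_mul]
    rw [Finset.sum_eq_single k, hu1 k x hx, mul_one]
    · intro l _ hl
      rw [hu0 l k hl.symm x hx, mul_zero]
    · simp
  let coord : σ → C(σ → ℝ, ℝ) := fun i => ⟨fun x => x i, continuous_apply i⟩
  have hsep : (aeval (R := ℝ) coord).range.SeparatesPoints := by
    intro x y hxy
    obtain ⟨i, hi⟩ := Function.ne_iff.1 hxy
    exact ⟨_, ⟨coord i, ⟨X i, by simp⟩, rfl⟩, hi⟩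
  obtain ⟨g, ⟨p, hp⟩, hg⟩ :=
    ContinuousMap.exists_mem_subalgebra_near_continuous_of_isCompact_of_separatesPoints hsep φ
      (isCompact_iUnion hK) (ε := 1 / 2) (by norm_num)
  have hgp : ∀ x, g x = eval x p := by
    intro x
    have : (ContinuousMap.evalAlgHom ℝ ℝ x).comp (aeval (R := ℝ) coord) = aeval x := by
      ext i
      simp [coord]
    have h2 := DFunLike.congr_fun this p
    rw [← hp]
    simpa [coe_aeval_eq_eval] using h2
  refine ⟨p, fun k l x hx y hy hxy => ?_⟩
  have h1 := hg x (Set.mem_iUnion_of_mem k hx)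
  have h2 := hg y (Set.mem_iUnion_of_mem l hy)
  rw [hφ k x hx, hgp, Real.norm_eq_abs, abs_lt] at h1
  rw [hφ l y hy, hgp, Real.norm_eq_abs, abs_lt] at h2
  have h3 : ((k : ℕ) : ℝ) < (l : ℕ) + 1 := by linarith
  have h4 : ((l : ℕ) : ℝ) < (k : ℕ) + 1 := by linarith
  norm_cast at h3 h4
  exact Fin.ext (by omega)

section LinearIndependence

variable {σ : Type*} [Fintype σ] [DecidableEq σ] {n : ℕ} {F : σ → MvPolynomial σ ℝ}
  {K : Fin n → Set (σ → ℝ)} {h : MvPolynomial σ ℝ} {q₀ : σ → ℝ}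

lemma linearIndependent_prod_pow_mul_pow
    (hh : ∀ k l, ∀ x ∈ K k, ∀ y ∈ K l, eval x h = eval y h → k = l)
    (hF : ∀ᶠ q in 𝓝 q₀, ∀ k, ∃ x ∈ K k, ∀ i, eval x (F i) = q i) (A : ℕ) :
    LinearIndependent ℝ fun p : exponents σ A × Fin n =>
      (∏ i, F i ^ p.1.1 i) * h ^ (p.2 : ℕ) := by
  rw [Fintype.linearIndependent_iff]
  intro c hc
  let C' : Fin n → MvPolynomial σ ℝ := fun j =>
    ∑ a : exponents σ A, monomial (Finsupp.equivFunOnFinite.symm a.1) (c (a, j))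
  have heval : ∀ q j, eval q (C' j) = ∑ a : exponents σ A, c (a, j) * ∏ i, q i ^ a.1 i := by
    intro q j
    simp only [C', map_sum, eval_monomial]
    refine Finset.sum_congr rfl fun a _ => ?_
    rw [Finsupp.prod_fintype _ _ (by simp)]
    rfl
  have hC : ∀ j, C' j = 0 := by
    intro j
    refine eq_zero_of_eventually_eval_eq_zero (x := q₀) ?_
    filter_upwards [hF] with q hq
    choose x hxK hx using hq
    refine congrFun (Matrix.eq_zero_of_forall_index_sum_mul_pow_eq_zero
      (f := fun k => eval (x k) h) (v := fun j => eval q (C' j))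
      (fun k l hkl => hh k l _ (hxK k) _ (hxK l) hkl) fun k => ?_) j
    have := congrArg (eval (x k)) hc
    rw [map_sum, map_zero, Fintype.sum_prod_type_right] at this
    rw [← this]
    refine Finset.sum_congr rfl fun j _ => ?_
    rw [heval, Finset.sum_mul]
    refine Finset.sum_congr rfl fun a _ => ?_
    simp only [smul_eval, map_mul, eval_prod, map_pow, hx, mul_assoc]
  rintro ⟨a, j⟩
  have := congrArg (coeff (Finsupp.equivFunOnFinite.symm a.1)) (hC j)
  rw [coeff_sum, Finset.sum_eq_single a] at this
  · simpa using this
  · intro b _ hb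
    rw [coeff_monomial, if_neg]
    exact fun h => hb (Subtype.ext (Finsupp.equivFunOnFinite.symm.injective h))
  · simp

/-- If the values of a polynomial map of degree at most `e` near some point are all attained on
each of `n` pairwise disjoint compact sets, then `n` is at most the Bézout number. -/
theorem card_le_pow {e : ℕ} (he : 0 < e) (hdeg : ∀ i, (F i).totalDegree ≤ e)
    (hK : ∀ k, IsCompact (K k)) (hdisj : Pairwise (Function.onFun Disjoint K))
    (hF : ∀ᶠ q in 𝓝 q₀, ∀ k, ∃ x ∈ K k, ∀ i, eval x (F i) = q i) :
    n ≤ e ^ Fintype.card σ := by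
  obtain ⟨h, hh⟩ := exists_separating_polynomial hK hdisj
  refine le_pow_of_forall_mul_card_exponents_le he (B := n * h.totalDegree) fun A => ?_
  have hli := linearIndependent_prod_pow_mul_pow hh hF A
  have hmem : ∀ p : exponents σ A × Fin n, (∏ i, F i ^ p.1.1 i) * h ^ (p.2 : ℕ) ∈
      restrictTotalDegree σ ℝ (e * A + n * h.totalDegree) := by
    rintro ⟨a, j⟩
    rw [mem_restrictTotalDegree]
    refine (totalDegree_mul _ _).trans (add_le_add ?_ ?_)
    · refine (totalDegree_finsetProd _ _).trans ?_
      calc ∑ i, (F i ^ a.1 i).totalDegree ≤ ∑ i, e * a.1 i := Finset.sum_le_sum fun i _ =>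
            (totalDegree_pow _ _).trans (by rw [mul_comm]; exact Nat.mul_le_mul_right _ (hdeg i))
        _ ≤ e * A := by
            rw [← Finset.mul_sum]; exact Nat.mul_le_mul_left _ (mem_exponents.1 a.2)
    · exact (totalDegree_pow _ _).trans (Nat.mul_le_mul_right _ j.2.le)
  have hli' : LinearIndependent ℝ fun p : exponents σ A × Fin n =>
      (⟨_, hmem p⟩ : restrictTotalDegree σ ℝ (e * A + n * h.totalDegree)) :=
    LinearIndependent.of_comp (Submodule.subtype _) hli
  have := hli'.fintype_card_le_finrank.trans (finrank_restrictTotalDegree_le _)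
  rwa [Fintype.card_prod, Fintype.card_coe, Fintype.card_fin, mul_comm] at this

end LinearIndependence

end FiberCount

namespace SignPatterns

open MvPolynomial Filter Topology

section Derivatives

variable {σ : Type*} [DecidableEq σ]

lemma hasDerivAt_eval_update (p : MvPolynomial σ ℝ) (x : σ → ℝ) (i : σ) (t : ℝ) :
    HasDerivAt (fun t => eval (Function.update x i t) p)
      (eval (Function.update x i t) (pderiv i p)) t := by
  induction p using MvPolynomial.induction_on with
  | C a => simpa using hasDerivAt_const t a
  | add p q hp hq =>
    simp only [map_add]
    exact hp.add hq
  | mul_X p j hp =>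
    have hX : HasDerivAt (fun t => Function.update x i t j) (if i = j then 1 else 0) t := by
      rcases eq_or_ne i j with rfl | hij
      · simp only [Function.update_self, if_true]
        exact hasDerivAt_id' t
      · simp only [Function.update_of_ne hij.symm, if_neg hij]
        exact hasDerivAt_const t (x j)
    simp only [map_mul, eval_X]
    refine (hp.mul hX).congr_deriv ?_
    rw [Derivation.leibniz, pderiv_X]
    rcases eq_or_ne i j with rfl | hij
    · simp; ring
    · simp [hij, hij.symm]; ring

lemma totalDegree_pderiv_le (p : MvPolynomial σ ℝ) (i : σ) :
    (pderiv i p).totalDegree ≤ p.totalDegree := by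
  conv_lhs => rw [p.as_sum, map_sum]
  refine totalDegree_finsetSum_le fun v hv => ?_
  rw [pderiv_monomial]
  refine (totalDegree_monomial_le _ _).trans (le_trans ?_ (le_totalDegree hv))
  exact Finsupp.sum_le_sum_index tsub_le_self (fun _ _ => monotone_id) fun _ _ => rfl

lemma eval_pderiv_eq_of_isLocalMin [Fintype σ] {p : MvPolynomial σ ℝ} {q x : σ → ℝ}
    (hx : IsLocalMin (fun y => eval y p - ∑ i, q i * y i) x) (i : σ) :
    eval x (pderiv i p) = q i := by
  have hd : HasDerivAt (fun t => eval (Function.update x i t) (p - ∑ i, C (q i) * X i))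
      (eval x (pderiv i p) - q i) (x i) := by
    convert hasDerivAt_eval_update (p - ∑ i, C (q i) * X i) x i (x i) using 1
    simp [pderiv_X, Pi.single_apply]
  have hmin : IsLocalMin (fun t => eval (Function.update x i t) (p - ∑ i, C (q i) * X i)) (x i) := by
    have hc : ContinuousAt (fun t => Function.update x i t) (x i) :=
      (continuous_const.update i continuous_id).continuousAt
    have htend : Tendsto (fun t => Function.update x i t) (𝓝 (x i)) (𝓝 x) := by
      simpa [ContinuousAt] using hc
    simpa [IsLocalMin, IsMinFilter] using htend.eventually hx
  exact sub_eq_zero.1 (hmin.hasDerivAt_eq_zero hd)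

end Derivatives

section StrictMinima

variable {σ : Type*} [Fintype σ] {n : ℕ}

/-- The squared distance to the origin. -/
noncomputable def sqNorm (σ : Type*) [Fintype σ] : MvPolynomial σ ℝ := ∑ i, X i ^ 2

lemma eval_sqNorm_nonneg (x : σ → ℝ) : 0 ≤ eval x (sqNorm σ) := by
  simp only [sqNorm, map_sum, map_pow, eval_X]
  positivity

lemma totalDegree_sqNorm_le : (sqNorm σ).totalDegree ≤ 2 :=
  totalDegree_finsetSum_le fun i _ => (totalDegree_pow _ _).trans (by simp)

lemma exists_penalty {H : MvPolynomial σ ℝ} {B : Set (σ → ℝ)} {c : ℝ} (hB : IsCompact B)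
    (hH0 : ∀ x ∈ B, 0 ≤ eval x H) (hc : 0 ≤ c)
    (hHc : ∀ x ∈ B, eval x H = 0 → c < eval x (sqNorm σ)) :
    ∀ᶠ ε in 𝓝[>] (0 : ℝ), ∀ x ∈ B, ε * c < eval x H + ε * eval x (sqNorm σ) := by
  set B' := B ∩ {x | eval x (sqNorm σ) ≤ c} with hB'
  have hB'c : IsCompact B' :=
    hB.inter_right (isClosed_le (continuous_eval _) continuous_const)
  obtain ⟨η, hη, hηB⟩ : ∃ η > 0, ∀ x ∈ B', η ≤ eval x H := by
    rcases B'.eq_empty_or_nonempty with h | h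
    · exact ⟨1, one_pos, by simp [h]⟩
    · obtain ⟨x, hx, hmin⟩ := hB'c.exists_isMinOn h (continuous_eval H).continuousOn
      refine ⟨eval x H, (hH0 x hx.1).lt_of_ne fun h0 => ?_, fun y hy => hmin hy⟩
      exact (hHc x hx.1 h0.symm).not_ge hx.2
  have hlt : (0 : ℝ) < η / (c + 1) := by positivity
  filter_upwards [Ioo_mem_nhdsGT hlt] with ε hε x hx
  rcases le_or_gt (eval x (sqNorm σ)) c with hle | hgt
  · have h1 := hηB x ⟨hx, hle⟩
    have h2 := (lt_div_iff₀ (by positivity)).1 hε.2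
    have h3 := mul_nonneg hε.1.le (eval_sqNorm_nonneg x)
    nlinarith [hε.1]
  · nlinarith [hH0 x hx, mul_lt_mul_of_pos_left hgt hε.1]

lemma eventually_exists_eval_pderiv_eq [DecidableEq σ] {Ψ : MvPolynomial σ ℝ} {K : Set (σ → ℝ)}
    (hK : IsCompact K) {z : σ → ℝ} (hz : z ∈ K)
    (h : ∀ x ∈ K \ interior K, eval z Ψ < eval x Ψ) :
    ∀ᶠ q in 𝓝 (0 : σ → ℝ), ∃ x ∈ K, ∀ i, eval x (pderiv i Ψ) = q i := by
  obtain ⟨G, hG⟩ : ∃ G : (σ → ℝ) → (σ → ℝ) → ℝ, ∀ q x, G q x = eval x Ψ - ∑ i, q i * x i :=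
    ⟨_, fun _ _ => rfl⟩
  have hcont : Continuous fun p : (σ → ℝ) × (σ → ℝ) => G p.1 p.2 := by
    have := (continuous_eval Ψ).comp (continuous_snd (X := σ → ℝ) (Y := σ → ℝ))
    simp only [hG]
    exact this.sub (by fun_prop)
  have hlt : ∀ᶠ q in 𝓝 (0 : σ → ℝ), ∀ x ∈ K \ interior K, G q z < G q x := by
    refine (hK.diff isOpen_interior).eventually_forall_of_forall_eventually fun x hx => ?_
    have h1 : Continuous fun p : (σ → ℝ) × (σ → ℝ) => G p.1 z :=
      hcont.comp (continuous_fst.prodMk continuous_const)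
    have h2 : G 0 z < G 0 x := by simpa [hG] using h x hx
    exact h1.continuousAt.eventually_lt hcont.continuousAt h2
  filter_upwards [hlt] with q hq
  have hq' : Continuous (G q) := hcont.comp (continuous_const.prodMk continuous_id)
  obtain ⟨x, hxK, hx⟩ := hK.exists_isMinOn ⟨z, hz⟩ hq'.continuousOn
  have hxint : x ∈ interior K := by
    by_contra hn
    exact (hq x ⟨hxK, hn⟩).not_ge (hx hz)
  have hG' : G q = fun y => eval y Ψ - ∑ i, q i * y i := funext (hG q)
  exact ⟨x, hxK, fun i =>
    eval_pderiv_eq_of_isLocalMin (hG' ▸ hx.isLocalMin (mem_interior_iff_mem_nhds.1 hxint)) i⟩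

/-- Bound on the number of disjoint open sets in each of which the squared distance to the origin,
restricted to the zero set of a nonnegative polynomial, has a nonempty compact set of minimizers. -/
theorem card_le_pow_of_strict_minima [DecidableEq σ] {H : MvPolynomial σ ℝ} {d : ℕ} (hd : 0 < d)
    (hdeg : H.totalDegree ≤ 2 * d) (hH : ∀ x, 0 ≤ eval x H) {V Z : Fin n → Set (σ → ℝ)}
    {c : Fin n → ℝ} (hV : ∀ k, IsOpen (V k)) (hdisj : Pairwise (Function.onFun Disjoint V))
    (hZ : ∀ k, IsCompact (Z k)) (hZne : ∀ k, (Z k).Nonempty) (hZV : ∀ k, Z k ⊆ V k)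
    (hZH : ∀ k, ∀ z ∈ Z k, eval z H = 0 ∧ eval z (sqNorm σ) = c k)
    (hmin : ∀ k, ∀ x ∈ V k, x ∉ Z k → eval x H = 0 → c k < eval x (sqNorm σ)) :
    n ≤ (2 * d) ^ Fintype.card σ := by
  choose K hK hZK hKV using fun k => exists_compact_between (hZ k) (hV k) (hZV k)
  choose z hz using hZne
  have hc : ∀ k, 0 ≤ c k := fun k => (hZH k _ (hz k)).2 ▸ eval_sqNorm_nonneg _
  have hB : ∀ k, IsCompact (K k \ interior (K k)) := fun k => (hK k).diff isOpen_interior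
  obtain ⟨ε, hε⟩ := (eventually_all.2 fun k => exists_penalty (hB k) (fun x _ => hH x) (hc k)
    fun x hx => hmin k x (hKV k hx.1) fun h => hx.2 (hZK k h)).exists
  let Ψ : MvPolynomial σ ℝ := H + C ε * sqNorm σ
  have hΨ : ∀ x, eval x Ψ = eval x H + ε * eval x (sqNorm σ) := fun x => by simp [Ψ]
  refine FiberCount.card_le_pow (F := fun i => pderiv i Ψ) (K := K) (q₀ := 0) (by omega)
    (fun i => (totalDegree_pderiv_le _ _).trans ?_) hK
    (hdisj.mono fun k l h => h.mono (hKV k) (hKV l)) ?_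
  · refine (totalDegree_add _ _).trans (max_le hdeg ((totalDegree_mul _ _).trans ?_))
    have := totalDegree_sqNorm_le (σ := σ)
    simp only [totalDegree_C]
    omega
  refine eventually_all.2 fun k => eventually_exists_eval_pderiv_eq (hK k)
    (interior_subset (hZK k (hz k))) fun x hx => ?_
  have h1 := hε k x hx
  obtain ⟨h2, h3⟩ := hZH k _ (hz k)
  simpa [hΨ, h2, h3] using h1

end StrictMinima

section GenericLevels

variable {σ ι : Type*} [Fintype σ]

lemma card_le_of_algebraicIndependent [Fintype ι] {Q : ι → MvPolynomial σ ℝ}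
    (hQ : AlgebraicIndependent ℝ Q) : Fintype.card ι ≤ Fintype.card σ := by
  have h := hQ.lift_cardinalMk_le_trdeg
  rw [MvPolynomial.trdeg_of_isDomain] at h
  simpa using h

lemma exists_eval_ne_zero_of_ne_zero {R : MvPolynomial ι ℝ} (hR : R ≠ 0) {η : ℝ} (hη : 0 < η) :
    ∃ u : ι → ℝ, (∀ i, u i ∈ Set.Ioo 0 η) ∧ eval u R ≠ 0 := by
  by_contra! h
  exact hR (MvPolynomial.funext_set (fun _ => Set.Ioo 0 η) (fun _ => Set.Ioo_infinite hη)
    fun u hu => by simpa using h u fun i => hu i (Set.mem_univ i))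

/-- Polynomials in `N` variables have arbitrarily small levels such that at most `N` of these levels
are attained, up to sign, at any given point. -/
theorem exists_generic_levels [Fintype ι] (P : ι → MvPolynomial σ ℝ) {η : ℝ} (hη : 0 < η) :
    ∃ δ : ι → ℝ, (∀ i, 0 < δ i) ∧ (∀ i, δ i < η) ∧
      ∀ x (S : Finset ι), (∀ i ∈ S, |eval x (P i)| = δ i) → S.card ≤ Fintype.card σ := by
  classical
  have hR : ∀ S : Finset ι, ∃ R : MvPolynomial ι ℝ, R ≠ 0 ∧
      (Fintype.card σ < S.card → ∀ (u : ι → ℝ) (x : σ → ℝ),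
        (∀ i ∈ S, eval x (P i) ^ 2 = u i) → eval u R = 0) := by
    intro S
    by_cases hS : Fintype.card σ < S.card
    swap
    · exact ⟨1, one_ne_zero, fun h => absurd h hS⟩
    have hdep : ¬ AlgebraicIndependent ℝ fun i : S => P i ^ 2 := fun h => by
      have := card_le_of_algebraicIndependent h
      rw [Fintype.card_coe] at this
      omega
    rw [algebraicIndependent_iff] at hdep
    push Not at hdep
    obtain ⟨R, hR0, hR⟩ := hdep
    refine ⟨rename (↑) R, fun h => hR ?_, fun _ u x hu => ?_⟩
    · exact rename_injective _ Subtype.val_injective (by simpa using h)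
    · have h1 := congrArg (aeval x) hR0
      rw [map_zero, comp_aeval_apply] at h1
      have h2 : (fun i : S => aeval x (P i ^ 2)) = u ∘ (↑) := by
        ext i
        simpa [coe_aeval_eq_eval] using hu i i.2
      rw [h2] at h1
      rwa [eval_rename, ← coe_aeval_eq_eval]
  choose R hR0 hR using hR
  obtain ⟨u, hu, huR⟩ := exists_eval_ne_zero_of_ne_zero
    (Finset.prod_ne_zero_iff.2 fun S (_ : S ∈ Finset.univ) => hR0 S) (sq_pos_of_pos hη)
  refine ⟨fun i => √(u i), fun i => Real.sqrt_pos.2 (hu i).1,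
    fun i => (Real.sqrt_lt' hη).2 (hu i).2, fun x S hS => ?_⟩
  by_contra! hlt
  refine huR ?_
  rw [map_prod]
  refine Finset.prod_eq_zero (Finset.mem_univ S) (hR S hlt u x fun i hi => ?_)
  rw [← sq_abs, hS i hi, Real.sq_sqrt (hu i).1.le]

end GenericLevels

lemma isCompact_sqNorm_le {σ : Type*} [Fintype σ] (R : ℝ) :
    IsCompact {x | eval x (sqNorm σ) ≤ R} := by
  refine (isCompact_univ_pi fun _ : σ => isCompact_Icc (a := -√R) (b := √R)).of_isClosed_subset
    (isClosed_le (continuous_eval _) continuous_const) fun x hx i _ => ?_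
  have h : x i ^ 2 ≤ R := by
    simp only [sqNorm, map_sum, map_pow, eval_X, Set.mem_ofPred_eq] at hx
    exact (Finset.single_le_sum (fun j _ => sq_nonneg (x j)) (Finset.mem_univ i)).trans hx
  exact abs_le.1 (Real.abs_le_sqrt h)

lemma card_filter_card_support_le {ι : Type*} [Fintype ι] [DecidableEq ι] (N : ℕ) :
    (Finset.univ.filter fun τ : ι → SignType =>
      (Finset.univ.filter fun i => τ i ≠ 0).card ≤ N).card ≤
      ∑ ℓ ∈ Finset.range (N + 1), 2 ^ ℓ * (Fintype.card ι).choose ℓ := by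
  let T : Finset ι → Finset (ι → SignType) := fun S =>
    Fintype.piFinset fun i => if i ∈ S then {1, -1} else {0}
  have hT : ∀ S, (T S).card = 2 ^ S.card := by
    intro S
    simp only [T, Fintype.card_piFinset]
    rw [Finset.prod_congr rfl (g := fun i => if i ∈ S then 2 else 1)
      fun i _ => by split_ifs <;> rfl]
    simp
  calc _ ≤ ((Finset.range (N + 1)).biUnion fun ℓ =>
        (Finset.univ.powersetCard ℓ).biUnion T).card := by
        refine Finset.card_le_card fun τ hτ => ?_
        simp only [Finset.mem_filter, Finset.mem_univ, true_and] at hτ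
        refine Finset.mem_biUnion.2 ⟨_, Finset.mem_range_succ_iff.2 hτ, Finset.mem_biUnion.2
          ⟨_, Finset.mem_powersetCard.2 ⟨Finset.subset_univ _, rfl⟩, ?_⟩⟩
        simp only [T, Fintype.mem_piFinset, Finset.mem_filter, Finset.mem_univ, true_and]
        intro i
        cases τ i <;> decide
    _ ≤ ∑ ℓ ∈ Finset.range (N + 1), ∑ S ∈ Finset.univ.powersetCard ℓ, (T S).card :=
        Finset.card_biUnion_le.trans (Finset.sum_le_sum fun _ _ => Finset.card_biUnion_le)
    _ = _ := by
        refine Finset.sum_congr rfl fun ℓ _ => ?_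
        rw [Finset.sum_congr rfl (g := fun _ => 2 ^ ℓ) fun S hS => by
          rw [hT, (Finset.mem_powersetCard.1 hS).2]]
        simp [mul_comm]

lemma eventually_sign_eq {E : Type*} [TopologicalSpace E] {f : E → ℝ} (hf : Continuous f)
    {x : E} (hx : f x ≠ 0) :
    ∀ᶠ y in 𝓝 x, SignType.sign (f y) = SignType.sign (f x) := by
  rcases hx.lt_or_gt with h | h
  · filter_upwards [hf.continuousAt.eventually_lt continuousAt_const h] with y hy
    rw [sign_neg h, sign_neg hy]
  · filter_upwards [continuousAt_const.eventually_lt hf.continuousAt h] with y hy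
    rw [sign_pos h, sign_pos hy]

section Cells

variable {σ ι : Type*} [Fintype ι] (P : ι → MvPolynomial σ ℝ)
  (F : ι → (σ → ℝ) → ℝ) (δ : ι → ℝ)

/-- The points at which the functions `F i` have signs `p`, no `P i` vanishes, and `|P i|`
exceeds `δ i` for all `i` outside the support of `τ`. -/
def cell (p τ : ι → SignType) : Set (σ → ℝ) :=
  {x | ∀ i, SignType.sign (F i x) = p i ∧ eval x (P i) ≠ 0 ∧ (τ i = 0 → δ i < |eval x (P i)|)}

/-- The points of the cell with signs `p` at which `|P i|` is at least `δ i` for all `i`. -/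
def closedCell (p : ι → SignType) : Set (σ → ℝ) :=
  {x | ∀ i, SignType.sign (F i x) = p i ∧ δ i ≤ |eval x (P i)|}

/-- A polynomial vanishing exactly where `P i = τ i * δ i` for all `i` in the support of `τ`. -/
noncomputable def levelPoly (τ : ι → SignType) : MvPolynomial σ ℝ :=
  ∑ i with τ i ≠ 0, (P i - C (τ i * δ i)) ^ 2

lemma eval_levelPoly (τ : ι → SignType) (x : σ → ℝ) :
    eval x (levelPoly P δ τ) = ∑ i with τ i ≠ 0, (eval x (P i) - τ i * δ i) ^ 2 := by
  simp [levelPoly]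

lemma eval_levelPoly_nonneg (τ : ι → SignType) (x : σ → ℝ) : 0 ≤ eval x (levelPoly P δ τ) := by
  rw [eval_levelPoly]
  positivity

lemma eval_levelPoly_eq_zero_iff {τ : ι → SignType} {x : σ → ℝ} :
    eval x (levelPoly P δ τ) = 0 ↔ ∀ i, τ i ≠ 0 → eval x (P i) = τ i * δ i := by
  rw [eval_levelPoly, Finset.sum_eq_zero_iff_of_nonneg fun _ _ => sq_nonneg _]
  simp [sub_eq_zero]

lemma totalDegree_levelPoly_le {d : ℕ} (hdeg : ∀ i, (P i).totalDegree ≤ d) (τ : ι → SignType) :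
    (levelPoly P δ τ).totalDegree ≤ 2 * d := by
  refine totalDegree_finsetSum_le fun i _ => (totalDegree_pow _ _).trans ?_
  gcongr
  exact (totalDegree_sub _ _).trans (max_le (hdeg i) (by rw [totalDegree_C]; exact zero_le))

variable {P F δ}

lemma isOpen_cell (hF : ∀ i, Continuous (F i)) (hFP : ∀ i x, F i x = 0 → eval x (P i) = 0)
    (p τ : ι → SignType) : IsOpen (cell P F δ p τ) := by
  refine isOpen_iff_mem_nhds.2 fun x hx => eventually_all.2 fun i => ?_
  obtain ⟨h1, h2, h3⟩ := hx i
  have hP := (continuous_eval (P i)).continuousAt (x := x)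
  refine .and ?_ (.and (hP.eventually_ne h2) ?_)
  · rw [← h1]
    exact eventually_sign_eq (hF i) (mt (hFP i x) h2)
  · by_cases hτ : τ i = 0
    · filter_upwards [continuousAt_const.eventually_lt hP.abs (h3 hτ)] with y hy _ using hy
    · exact .of_forall fun y h => absurd h hτ

omit [Fintype ι] in
lemma isClosed_closedCell (hF : ∀ i, Continuous (F i))
    (hFP : ∀ i x, F i x = 0 → eval x (P i) = 0) (hδ : ∀ i, 0 < δ i) (p : ι → SignType) :
    IsClosed (closedCell P F δ p) := by
  refine isClosed_of_closure_subset fun x hx i => ?_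
  have hle : δ i ≤ |eval x (P i)| :=
    closure_minimal (fun y hy => (hy i).2)
      (isClosed_le continuous_const (continuous_eval (P i)).abs) hx
  refine ⟨?_, hle⟩
  have hne : F i x ≠ 0 := fun h => by
    rw [hFP i x h, abs_zero] at hle
    exact hle.not_gt (hδ i)
  obtain ⟨y, hy, hyC⟩ :=
    ((mem_closure_iff_frequently.1 hx).and_eventually (eventually_sign_eq (hF i) hne)).exists
  rw [← hyC, (hy i).1]

variable [Fintype σ]

/-- The points of a closed cell that are nearest to the origin, among them those with the largest
set of active constraints. -/
lemma exists_cell_minimizers (hF : ∀ i, Continuous (F i))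
    (hFP : ∀ i x, F i x = 0 → eval x (P i) = 0) (hδ : ∀ i, 0 < δ i)
    (hgen : ∀ x (S : Finset ι), (∀ i ∈ S, |eval x (P i)| = δ i) → S.card ≤ Fintype.card σ)
    {p : ι → SignType} (hne : (closedCell P F δ p).Nonempty) :
    ∃ (τ : ι → SignType) (c : ℝ) (Z : Set (σ → ℝ)),
      (Finset.univ.filter fun i => τ i ≠ 0).card ≤ Fintype.card σ ∧
      IsCompact Z ∧ Z.Nonempty ∧ Z ⊆ cell P F δ p τ ∧
      (∀ z ∈ Z, eval z (levelPoly P δ τ) = 0 ∧ eval z (sqNorm σ) = c) ∧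
      ∀ x ∈ cell P F δ p τ, x ∉ Z → eval x (levelPoly P δ τ) = 0 → c < eval x (sqNorm σ) := by
  classical
  have hclosed := isClosed_closedCell hF hFP hδ p
  have hρ := continuous_eval (sqNorm σ)
  obtain ⟨y, hy⟩ := hne
  obtain ⟨w, ⟨hwC, hwy⟩, hw⟩ := ((isCompact_sqNorm_le _).inter_left hclosed).exists_isMinOn
    ⟨y, hy, le_refl (eval y (sqNorm σ))⟩ hρ.continuousOn
  have hwmin : ∀ x ∈ closedCell P F δ p, eval w (sqNorm σ) ≤ eval x (sqNorm σ) := by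
    intro x hx
    rcases le_total (eval x (sqNorm σ)) (eval y (sqNorm σ)) with h | h
    · exact hw ⟨hx, h⟩
    · exact hwy.trans h
  set c := eval w (sqNorm σ)
  let M := closedCell P F δ p ∩ {x | eval x (sqNorm σ) = c}
  have hM : IsCompact M := (isCompact_sqNorm_le c).of_isClosed_subset
    (hclosed.inter (isClosed_eq hρ continuous_const)) fun x hx => hx.2.le
  let A : (σ → ℝ) → Finset ι := fun x => {i | |eval x (P i)| = δ i}
  obtain ⟨-, ⟨z, hz, rfl⟩, hmax⟩ := Set.exists_max_image (A '' M) Finset.card (Set.toFinite _)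
    (Set.Nonempty.image A ⟨w, hwC, rfl⟩)
  have hmax' : ∀ x ∈ M, (A x).card ≤ (A z).card := fun x hx => hmax _ ⟨x, hx, rfl⟩
  have hPne : ∀ x ∈ closedCell P F δ p, ∀ i, eval x (P i) ≠ 0 := fun x hx i =>
    abs_pos.1 ((hδ i).trans_le (hx i).2)
  let τ : ι → SignType := fun i =>
    if |eval z (P i)| = δ i then SignType.sign (eval z (P i)) else 0
  have hτ : ∀ i, τ i ≠ 0 ↔ |eval z (P i)| = δ i := by
    intro i
    by_cases h : |eval z (P i)| = δ i <;> simp [τ, h, hPne z hz.1 i]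
  have hzτ : ∀ i, τ i ≠ 0 → eval z (P i) = τ i * δ i := by
    intro i hi
    have h := (hτ i).1 hi
    simp only [τ, if_pos h]
    rw [← h, sign_mul_abs]
  have habs : ∀ x, eval x (levelPoly P δ τ) = 0 → ∀ i, τ i ≠ 0 → |eval x (P i)| = δ i := by
    intro x hx i hi
    rw [(eval_levelPoly_eq_zero_iff P δ).1 hx i hi, ← hzτ i hi, (hτ i).1 hi]
  refine ⟨τ, c, M ∩ {x | eval x (levelPoly P δ τ) = 0}, ?_, ?_, ?_, ?_, ?_, ?_⟩
  · exact hgen z _ fun i hi => (hτ i).1 (Finset.mem_filter.1 hi).2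
  · exact hM.inter_right (isClosed_eq (continuous_eval _) continuous_const)
  · exact ⟨z, hz, (eval_levelPoly_eq_zero_iff P δ).2 hzτ⟩
  · rintro x ⟨hxM, hx⟩ i
    refine ⟨(hxM.1 i).1, hPne x hxM.1 i, fun hi => (hxM.1 i).2.lt_of_ne fun heq => ?_⟩
    refine (hmax' x hxM).not_gt (Finset.card_lt_card (Finset.ssubset_iff_exists_cons_subset.2 ?_))
    refine ⟨i, fun h => (hτ i).2 (Finset.mem_filter.1 h).2 hi, Finset.cons_subset.2 ⟨?_, ?_⟩⟩
    · exact Finset.mem_filter.2 ⟨Finset.mem_univ i, heq.symm⟩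
    · intro j hj
      exact Finset.mem_filter.2 ⟨Finset.mem_univ j,
        habs x hx j ((hτ j).2 (Finset.mem_filter.1 hj).2)⟩
  · rintro x ⟨hxM, hx⟩
    exact ⟨hx, hxM.2⟩
  · intro x hxV hxZ hx
    have hxC : x ∈ closedCell P F δ p := by
      refine fun i => ⟨(hxV i).1, ?_⟩
      by_cases hi : τ i = 0
      · exact ((hxV i).2.2 hi).le
      · exact (habs x hx i hi).ge
    exact (hwmin x hxC).lt_of_ne fun h => hxZ ⟨⟨hxC, h.symm⟩, hx⟩

/-- Warren-type bound for the number of sign patterns of continuous functions whose zero sets lie on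
hypersurfaces of degree at most `d`, provided the sample points avoid these hypersurfaces. -/
theorem card_le_of_sign_patterns {κ : Type*} [Fintype κ] {d : ℕ} (hd : 0 < d)
    (hdeg : ∀ i, (P i).totalDegree ≤ d) (hF : ∀ i, Continuous (F i))
    (hFP : ∀ i x, F i x = 0 → eval x (P i) = 0) {y : κ → σ → ℝ}
    (hy : ∀ k i, eval (y k) (P i) ≠ 0)
    (hinj : Function.Injective fun k i => SignType.sign (F i (y k))) :
    Fintype.card κ ≤ (2 * d) ^ Fintype.card σ *
      ∑ ℓ ∈ Finset.range (Fintype.card σ + 1), 2 ^ ℓ * (Fintype.card ι).choose ℓ := by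
  classical
  obtain ⟨η, hη, hηy⟩ : ∃ η > 0, ∀ k i, η ≤ |eval (y k) (P i)| := by
    have : ∀ᶠ η in 𝓝[>] (0 : ℝ), ∀ k i, η ≤ |eval (y k) (P i)| :=
      eventually_all.2 fun k => eventually_all.2 fun i => Filter.mem_of_superset
        (Ioo_mem_nhdsGT (abs_pos.2 (hy k i))) fun η h => h.2.le
    exact (this.and self_mem_nhdsWithin).exists.imp fun η h => ⟨h.2, h.1⟩
  obtain ⟨δ, hδ, hδη, hgen⟩ := exists_generic_levels P hη
  choose τ c Z hτ hZ hZne hZV hZH hmin using fun k => exists_cell_minimizers hF hFP hδ hgen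
    (p := fun i => SignType.sign (F i (y k)))
    ⟨y k, fun i => ⟨rfl, (hδη i).le.trans (hηy k i)⟩⟩
  refine (Finset.card_le_mul_card_image_of_maps_to (f := τ) (t := Finset.univ.filter fun τ =>
    (Finset.univ.filter fun i => τ i ≠ 0).card ≤ Fintype.card σ)
    (fun k _ => Finset.mem_filter.2 ⟨Finset.mem_univ _, hτ k⟩) ((2 * d) ^ Fintype.card σ)
    fun τ₀ _ => ?_).trans (Nat.mul_le_mul_left _ (card_filter_card_support_le _))
  let e := (Finset.univ.filter fun k => τ k = τ₀).equivFin.symm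
  have he : ∀ j, τ (e j) = τ₀ := fun j => (Finset.mem_filter.1 (e j).2).2
  refine card_le_pow_of_strict_minima (V := fun j => cell P F δ _ τ₀) (Z := fun j => Z (e j))
    (c := fun j => c (e j)) hd (totalDegree_levelPoly_le P δ hdeg τ₀)
    (eval_levelPoly_nonneg P δ τ₀) (fun j => isOpen_cell hF hFP _ _) ?_ (fun j => hZ _)
    (fun j => hZne _) (fun j => he j ▸ hZV (e j))
    (fun j => by simpa only [he j] using hZH (e j))
    (fun j => by simpa only [he j] using hmin (e j))
  intro j l hjl
  refine Set.disjoint_left.2 fun x hxj hxl => hjl (e.injective (Subtype.ext (hinj ?_)))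
  ext1 i
  exact (hxj i).1.symm.trans (hxl i).1

end Cells

end SignPatterns

lemma Real.coe_signType_sign (x : ℝ) : ((SignType.sign x : SignType) : ℝ) = Real.sign x := by
  rcases lt_trichotomy x 0 with h | rfl | h
  · simp [_root_.sign_neg h, Real.sign_of_neg h]
  · simp
  · simp [_root_.sign_pos h, Real.sign_of_pos h]

/-- A sum of radicals with at most `r` terms can be padded to one with exactly `r` terms. -/
lemma MvPolynomial.exists_pad_sum_radicals {σ : Type*} {n r s Δ : ℕ} (hnr : n ≤ r) (a : Fin n → ℝ)
    (g : Fin n → MvPolynomial σ ℝ) (hdeg : ∀ j, (g j).totalDegree ≤ Δ)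
    (hpos : ∀ j x, 0 ≤ eval x (g j)) :
    ∃ (a' : Fin r → ℝ) (g' : Fin r → MvPolynomial σ ℝ), (∀ j, (g' j).totalDegree ≤ Δ) ∧
      (∀ j x, 0 ≤ eval x (g' j)) ∧
      ∀ x, ∑ j, a j * eval x (g j) ^ ((s : ℝ)⁻¹) = ∑ j, a' j * eval x (g' j) ^ ((s : ℝ)⁻¹) := by
  obtain ⟨k, rfl⟩ := Nat.exists_eq_add_of_le hnr
  refine ⟨Fin.append a 0, Fin.append g 0, fun j => ?_, fun j x => ?_, fun x => ?_⟩
  · refine Fin.addCases (fun j => ?_) (fun j => ?_) j <;> simp [hdeg]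
  · refine Fin.addCases (fun j => ?_) (fun j => ?_) j <;> simp [hpos]
  · simp [Fin.sum_univ_add]

open Finset in
/-- An analogue of Warren's theorem for sums of radicals of nonnegative polynomials:
if each `f i : ℝ^N → ℝ` has the form `Σ_{j=1}^{r_i} a_{i,j} g_{i,j}^{1/s}` with
`1 ≤ r_i ≤ r`, each `g_{i,j}` a polynomial of degree at most `Δ` which is nonnegative
on all of `ℝ^N`, then the number of distinct proper sign patterns
`(sgn f₁(x), …, sgn f_m(x))` is at most `2 (2 s^{r−2} Δ)^N Σ_{ℓ=0}^N 2^ℓ (m choose ℓ)`. -/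
theorem sign_patterns_of_sums_of_radicals (N m Δ r s : ℕ)
    (hN : 0 < N) (hm : 0 < m) (hΔ : 0 < Δ) (hr : 2 ≤ r) (hs : 0 < s)
    (f : Fin m → (Fin N → ℝ) → ℝ)
    (hf : ∀ i : Fin m, ∃ ri : ℕ, 0 < ri ∧ ri ≤ r ∧
      ∃ (a : Fin ri → ℝ) (g : Fin ri → MvPolynomial (Fin N) ℝ),
        (∀ j, (g j).totalDegree ≤ Δ) ∧
        (∀ j, ∀ x : Fin N → ℝ, 0 ≤ MvPolynomial.eval x (g j)) ∧
        (∀ x : Fin N → ℝ, f i x = ∑ j, a j * (MvPolynomial.eval x (g j)) ^ ((s : ℝ)⁻¹))) :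
    Nat.card {p : Fin m → ℝ | ∃ x : Fin N → ℝ, (∀ i, f i x ≠ 0) ∧
        p = fun i => Real.sign (f i x)} ≤
      2 * (2 * s ^ (r - 2) * Δ) ^ N * ∑ ℓ ∈ Finset.range (N + 1), 2 ^ ℓ * m.choose ℓ := by
  obtain ⟨q, rfl⟩ : ∃ q, r = q + 2 := ⟨r - 2, by omega⟩
  rw [Nat.add_sub_cancel]
  have : NeZero s := ⟨hs.ne'⟩
  set W : Set (Fin m → ℝ) := {p | ∃ x : Fin N → ℝ, (∀ i, f i x ≠ 0) ∧
    p = fun i => Real.sign (f i x)}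
  have hWfin : W.Finite := by
    refine (Set.finite_range fun (p : Fin m → SignType) i => ((p i : SignType) : ℝ)).subset ?_
    rintro _ ⟨x, -, rfl⟩
    exact ⟨fun i => SignType.sign (f i x), funext fun i => Real.coe_signType_sign _⟩
  have := hWfin.fintype
  choose y hy hyW using fun p : W => p.2
  have hpert : ∀ i, ∃ (F : (Fin N → ℝ) → ℝ) (P : MvPolynomial (Fin N) ℝ), Continuous F ∧
      P.totalDegree ≤ s ^ q * Δ ∧ (∀ x, F x = 0 → MvPolynomial.eval x P = 0) ∧
      ∀ x ∈ Set.range y, MvPolynomial.eval x P ≠ 0 ∧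
        SignType.sign (F x) = SignType.sign (f i x) := by
    intro i
    obtain ⟨ri, -, hri, a, g, hdeg, hpos, hfi⟩ := hf i
    obtain ⟨a', g', hdeg', hpos', hsum⟩ :=
      MvPolynomial.exists_pad_sum_radicals (s := s) hri a g hdeg hpos
    simp only [hfi, hsum]
    refine RadicalNorm.exists_perturbation a' g' hdeg' hpos' _ (Set.finite_range y) ?_
    rintro _ ⟨p, rfl⟩
    rw [← hsum, ← hfi]
    exact hy p i
  choose F P hF hdeg hFP hFy using hpert
  have hbound := SignPatterns.card_le_of_sign_patterns (P := P) (F := F) (y := y)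
    (d := s ^ q * Δ) (by positivity) hdeg hF hFP (fun k i => (hFy i _ ⟨k, rfl⟩).1) ?_
  · rw [Fintype.card_fin, Fintype.card_fin, ← mul_assoc] at hbound
    rw [Nat.card_eq_fintype_card]
    refine hbound.trans ?_
    gcongr
    exact Nat.le_mul_of_pos_left _ two_pos
  · intro k l hkl
    refine Subtype.ext ((hyW k).trans (Eq.trans ?_ (hyW l).symm))
    ext1 i
    have h := congrFun hkl i
    simp only [(hFy i _ ⟨k, rfl⟩).2, (hFy i _ ⟨l, rfl⟩).2] at h
    rw [← Real.coe_signType_sign, h, Real.coe_signType_sign]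
end
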